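/- arXiv:0908.1956 — 2 statements merged into one kernel-verified Lean document; each statement's English description precedes it below -/
import Mathlib

section
/- Spanning tree enumeration for cubes: For all n ≥ 1 and 1 ≤ k ≤ n, the torsion-weighted count of cellular spanning k-trees of the cube Q_n satisfies τ_k(Q_n) = ∏_{j=k+1}^n (2j)^{binom(n,j) · binom(j−2,k−1)} (an empty product, equal to 1, when k = n). -/
open BigOperators Matrix

namespace CubicalPaper

/-- Faces of the `n`-cube `Q_n`: tuples in `{0, 1, ✱}ⁿ`, with `2 : Fin 3` playing the
role of `✱`. -/
abbrev Face (n : ℕ) : Type := Fin n → Fin 3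

/-- The direction set of a face: the coordinates equal to `✱`. -/
def dir {n : ℕ} (f : Face n) : Finset (Fin n) := Finset.univ.filter fun i => f i = 2

/-- The dimension of a face. -/
def fdim {n : ℕ} (f : Face n) : ℕ := (dir f).card

/-- The incidence sign `ε(f, g)`: if `dir g = {a_1 < ⋯ < a_i}` and `f` is obtained from
`g` by changing the entry `g (a_j) = ✱` to `0` (resp. `1`), then `ε(f,g) = (-1)^j`
(resp. `(-1)^(j+1)`); in all other cases `ε(f,g) = 0`. -/
def eps {n : ℕ} (f g : Face n) : ℤ :=
  ∑ a : Fin n,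
    if g a = 2 ∧ f a ≠ 2 ∧ ∀ b, b ≠ a → f b = g b then
      (-1 : ℤ) ^ ((Finset.univ.filter fun b => g b = 2 ∧ b ≤ a).card +
        if f a = 1 then 1 else 0)
    else 0

/-- The `k`-dimensional faces of the full cube `Q_n`. -/
abbrev CFace (n k : ℕ) : Type := {f : Face n // fdim f = k}

/-- The integer cubical boundary matrix `∂_{k+1}` of `Q_n`. -/
def bdZ (n k : ℕ) : Matrix (CFace n k) (CFace n (k + 1)) ℤ :=
  Matrix.of fun f g => eps f.1 g.1

/-- The augmentation `ε : ℤ^{(Q_n)_0} → ℤ`. -/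
def augC (n : ℕ) : (CFace n 0 → ℤ) →ₗ[ℤ] ℤ where
  toFun v := ∑ i, v i
  map_add' u v := by simp [Finset.sum_add_distrib]
  map_smul' r v := by simp [Finset.mul_sum]

/-- The rational augmentation. -/
def augCQ (n : ℕ) : (CFace n 0 → ℚ) →ₗ[ℚ] ℚ where
  toFun v := ∑ i, v i
  map_add' u v := by simp [Finset.sum_add_distrib]
  map_smul' r v := by simp [Finset.mul_sum]

/-- Reduced cycles of `Q_n`: `ZkerC n i = ker ∂_i` (with `∂_0 = ε`). -/
def ZkerC (n : ℕ) : (i : ℕ) → Submodule ℤ (CFace n i → ℤ)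
  | 0 => LinearMap.ker (augC n)
  | (i + 1) => LinearMap.ker (Matrix.toLin' (bdZ n i))

/-- Rational reduced cycles of `Q_n`: the kernel of `∂_i ⊗ ℚ`. -/
def ZkerCQ (n : ℕ) : (i : ℕ) → Submodule ℚ (CFace n i → ℚ)
  | 0 => LinearMap.ker (augCQ n)
  | (i + 1) => LinearMap.ker (Matrix.toLin' ((bdZ n i).map (Int.cast : ℤ → ℚ)))

/-- The span of the columns of `∂_{j+1}` indexed by `T`. -/
def colSpanC (n j : ℕ) (T : Finset (CFace n (j + 1))) :
    Submodule ℤ (CFace n j → ℤ) :=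
  Submodule.span ℤ ((fun t => (bdZ n j)ᵀ t) '' (T : Set (CFace n (j + 1))))

/-- For a set `T` of `(j+1)`-faces of `Q_n`, the homology `H_j(X_T)` of the
subcomplex `X_T`. -/
abbrev HsubC (n j : ℕ) (T : Finset (CFace n (j + 1))) : Type :=
  ZkerC n j ⧸ (colSpanC n j T).comap (ZkerC n j).subtype

/-- `T` is a cellular spanning `(j+1)`-tree of `Q_n`. -/
def IsTreeC (n j : ℕ) (T : Finset (CFace n (j + 1))) : Prop :=
  LinearIndependent ℤ (fun t : {f // f ∈ T} => (bdZ n j)ᵀ (t : CFace n (j + 1)))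
    ∧ Nat.card (HsubC n j T) ≠ 0
    ∧ T.card = Module.finrank ℚ (ZkerCQ n j)

open Classical in
/-- The torsion-weighted count `τ_{j+1}(Q_n)` of cellular spanning `(j+1)`-trees. -/
noncomputable def tauC (n j : ℕ) : ℕ :=
  ∑ T : Finset (CFace n (j + 1)),
    if IsTreeC n j T then (Nat.card (HsubC n j T)) ^ 2 else 0

/-! ### The cubical boundary matrix on all faces -/

theorem sum_face_succ {M : Type*} [AddCommMonoid M] {n : ℕ} (F : Face (n + 1) → M) :
    ∑ f, F f = ∑ f : Face n, F (Fin.cons 0 f) + ∑ f : Face n, F (Fin.cons 1 f)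
      + ∑ f : Face n, F (Fin.cons 2 f) := by
  rw [← (Fin.consEquiv fun _ : Fin (n + 1) => Fin 3).sum_comp, Fintype.sum_prod_type,
    Fin.sum_univ_three]
  rfl

theorem prod_face_succ {M : Type*} [CommMonoid M] {n : ℕ} (F : Face (n + 1) → M) :
    ∏ f, F f = (∏ f : Face n, F (Fin.cons 0 f)) * (∏ f : Face n, F (Fin.cons 1 f))
      * ∏ f : Face n, F (Fin.cons 2 f) := by
  rw [← (Fin.consEquiv fun _ : Fin (n + 1) => Fin 3).prod_comp, Fintype.prod_prod_type,
    Fin.prod_univ_three]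
  rfl

theorem fdim_cons {n : ℕ} (x : Fin 3) (f : Face n) :
    fdim (Fin.cons x f : Face (n + 1)) = (if x = 2 then 1 else 0) + fdim f := by
  simp only [fdim, dir, Finset.card_filter, Fin.sum_univ_succ, Fin.cons_zero, Fin.cons_succ]

theorem eps_cons {n : ℕ} (x y : Fin 3) (f g : Face n) :
    eps (Fin.cons x f : Face (n + 1)) (Fin.cons y g) =
      (if y = 2 ∧ x ≠ 2 ∧ f = g then (if x = 1 then 1 else -1) else 0)
        + if x = y then (if y = 2 then -eps f g else eps f g) else 0 := by
  unfold eps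
  rw [Fin.sum_univ_succ]
  congr 1
  · have h : (∀ b : Fin (n + 1), b ≠ 0 →
        (Fin.cons x f : Face (n + 1)) b = (Fin.cons y g : Face (n + 1)) b) ↔ f = g := by
      simp [Fin.forall_fin_succ, funext_iff]
    simp only [h, Fin.cons_zero]
    have hc : (Finset.univ.filter fun b : Fin (n + 1) =>
        (Fin.cons y g : Face (n + 1)) b = 2 ∧ b ≤ 0).card = if y = 2 then 1 else 0 := by
      rw [Finset.card_filter, Fin.sum_univ_succ]
      simp
    rw [hc]
    split_ifs <;> simp_all
  · have hc (a : Fin n) : (Finset.univ.filter fun b : Fin (n + 1) =>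
        (Fin.cons y g : Face (n + 1)) b = 2 ∧ b ≤ a.succ).card =
          (if y = 2 then 1 else 0) + (Finset.univ.filter fun b => g b = 2 ∧ b ≤ a).card := by
      rw [Finset.card_filter, Finset.card_filter, Fin.sum_univ_succ]
      simp only [Fin.cons_zero, Fin.zero_le, and_true, Fin.cons_succ, Fin.succ_le_succ_iff]
    have h (a : Fin n) : (∀ b : Fin (n + 1), b ≠ a.succ →
        (Fin.cons x f : Face (n + 1)) b = (Fin.cons y g : Face (n + 1)) b) ↔
          x = y ∧ ∀ b, b ≠ a → f b = g b := by
      simp [Fin.forall_fin_succ, (Fin.succ_ne_zero a).symm]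
    simp only [h, hc, Fin.cons_succ]
    by_cases hxy : x = y
    · by_cases hy : y = 2
      · simp only [hxy, hy, if_true, true_and]
        rw [← Finset.sum_neg_distrib]
        refine Finset.sum_congr rfl fun a _ => ?_
        split_ifs <;> ring
      · simp [hxy, hy]
    · simp [hxy]

/-- The boundary map of the `n`-cube, as a matrix on faces of all dimensions. -/
def bd (n : ℕ) : Matrix (Face n) (Face n) ℤ := Matrix.of eps

theorem bd_cons {n : ℕ} (x y : Fin 3) (f g : Face n) :
    bd (n + 1) (Fin.cons x f) (Fin.cons y g) =
      (if y = 2 ∧ x ≠ 2 then (if x = 1 then (1 : Matrix (Face n) (Face n) ℤ) f g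
        else -(1 : Matrix (Face n) (Face n) ℤ) f g) else 0)
        + if x = y then (if y = 2 then -bd n f g else bd n f g) else 0 := by
  simp only [bd, Matrix.of_apply, eps_cons, Matrix.one_apply]
  split_ifs <;> simp_all

theorem bd_mul_bd (n : ℕ) : bd n * bd n = 0 := by
  induction n with
  | zero => ext f g; simp [Matrix.mul_apply, bd, eps]
  | succ n ih =>
    ext f g
    obtain ⟨⟨x, f⟩, rfl⟩ := (Fin.consEquiv fun _ : Fin (n + 1) => Fin 3).surjective f
    obtain ⟨⟨y, g⟩, rfl⟩ := (Fin.consEquiv fun _ : Fin (n + 1) => Fin 3).surjective g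
    have h := congrFun (congrFun ih f) g
    simp only [Matrix.mul_apply, Matrix.zero_apply] at h
    simp only [Fin.consEquiv, Equiv.coe_fn_mk, Matrix.mul_apply, sum_face_succ, bd_cons]
    fin_cases x <;> fin_cases y <;> simp [h, Matrix.one_apply]

/-- The total Laplacian of the `n`-cube, on faces of all dimensions. -/
def lap (n : ℕ) : Matrix (Face n) (Face n) ℤ := bd n * (bd n)ᵀ + (bd n)ᵀ * bd n

theorem lap_cons {n : ℕ} (x y : Fin 3) (f g : Face n) :
    lap (n + 1) (Fin.cons x f) (Fin.cons y g) =
      if x = y then lap n f g + (if x = 2 then 2 else 1) * (1 : Matrix (Face n) (Face n) ℤ) f g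
      else if x = 2 ∨ y = 2 then 0 else -(1 : Matrix (Face n) (Face n) ℤ) f g := by
  simp only [lap, Matrix.mul_apply, Matrix.add_apply, Matrix.transpose_apply, sum_face_succ,
    bd_cons]
  fin_cases x <;> fin_cases y <;>
    simp [Matrix.one_apply, eq_comm] <;> split_ifs <;> ring

/-- The number of coordinates of a face different from `0`. -/
def supp {n : ℕ} (f : Face n) : ℕ := ∑ i, if f i = 0 then 0 else 1

theorem supp_cons {n : ℕ} (x : Fin 3) (f : Face n) :
    supp (Fin.cons x f : Face (n + 1)) = (if x = 0 then 0 else 1) + supp f := by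
  simp only [supp, Fin.sum_univ_succ, Fin.cons_zero, Fin.cons_succ]

theorem bd_apply_eq_zero {n : ℕ} (f g : Face n) (h : fdim g ≠ fdim f + 1) : bd n f g = 0 := by
  induction n with
  | zero => simp [bd, eps]
  | succ n ih =>
    obtain ⟨⟨x, f⟩, rfl⟩ := (Fin.consEquiv fun _ : Fin (n + 1) => Fin 3).surjective f
    obtain ⟨⟨y, g⟩, rfl⟩ := (Fin.consEquiv fun _ : Fin (n + 1) => Fin 3).surjective g
    simp only [Fin.consEquiv, Equiv.coe_fn_mk, fdim_cons, bd_cons] at h ⊢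
    by_cases hd : fdim g = fdim f + 1
    · have hfg : f ≠ g := by rintro rfl; omega
      by_cases hxy : x = y
      · subst hxy; omega
      · simp [hfg, hxy]
    · rw [ih f g hd]
      by_cases hfg : f = g
      · subst hfg
        by_cases hx : x = 2 <;> by_cases hy : y = 2 <;> simp_all
        omega
      · simp [hfg]

theorem det_of_two_by_two_circulant {m : Type*} [Fintype m] [DecidableEq m]
    (A B : Matrix m m ℤ) :
    (Matrix.fromBlocks A B B A).det = (A + B).det * (A - B).det := by
  have h : Matrix.fromBlocks 1 1 0 1 * Matrix.fromBlocks A B B A =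
      Matrix.fromBlocks (A + B) 0 B (A - B) * Matrix.fromBlocks (1 : Matrix m m ℤ) 1 0 1 := by
    simp [Matrix.fromBlocks_multiply, add_comm]
  have h' := congrArg Matrix.det h
  simpa [Matrix.det_mul] using h'

/-- The affine expressions in the total Laplacian whose coefficients depend on the dimension. -/
def lapAffine (n : ℕ) (a b : ℕ → ℤ) : Matrix (Face n) (Face n) ℤ :=
  Matrix.of fun f g => a (fdim f) * (1 : Matrix (Face n) (Face n) ℤ) f g + b (fdim f) * lap n f g

theorem lapAffine_cons {n : ℕ} (a b : ℕ → ℤ) (x y : Fin 3) (f g : Face n) :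
    lapAffine (n + 1) a b (Fin.cons x f) (Fin.cons y g) =
      if x = y then
        if x = 2 then
          lapAffine n (fun i => a (i + 1) + 2 * b (i + 1)) (fun i => b (i + 1)) f g
        else lapAffine n (fun i => a i + b i) b f g
      else if x = 2 ∨ y = 2 then 0
      else -(Matrix.diagonal (fun h : Face n => b (fdim h)) f g) := by
  simp only [lapAffine, Matrix.of_apply, lap_cons, fdim_cons, Matrix.one_apply,
    Matrix.diagonal_apply]
  by_cases hfg : f = g
  · subst hfg
    fin_cases x <;> fin_cases y <;> simp [add_comm] <;> ring
  · fin_cases x <;> fin_cases y <;> simp [add_comm, hfg]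

theorem det_lapAffine (n : ℕ) (a b : ℕ → ℤ) :
    (lapAffine n a b).det = ∏ f : Face n, (a (fdim f) + 2 * supp f * b (fdim f)) := by
  induction n generalizing a b with
  | zero => simp [lapAffine, lap, supp, bd, eps, Matrix.mul_apply]
  | succ n ih =>
    let e : (Face n ⊕ Face n) ⊕ Face n ≃ Face (n + 1) :=
      { toFun := Sum.elim (Sum.elim (fun f => Fin.cons 0 f) fun f => Fin.cons 1 f)
          fun f => Fin.cons 2 f
        invFun := fun f => if f 0 = 0 then .inl (.inl (Fin.tail f)) else
          if f 0 = 1 then .inl (.inr (Fin.tail f)) else .inr (Fin.tail f)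
        left_inv := by rintro ((f | f) | f) <;> simp
        right_inv := by
          intro f
          obtain ⟨⟨x, f⟩, rfl⟩ := (Fin.consEquiv fun _ : Fin (n + 1) => Fin 3).surjective f
          fin_cases x <;> simp [Fin.consEquiv] }
    have he : (lapAffine (n + 1) a b).submatrix e e = Matrix.fromBlocks
        (Matrix.fromBlocks (lapAffine n (fun i => a i + b i) b)
          (-Matrix.diagonal (fun h : Face n => b (fdim h)))
          (-Matrix.diagonal (fun h : Face n => b (fdim h)))
          (lapAffine n (fun i => a i + b i) b)) 0 0
        (lapAffine n (fun i => a (i + 1) + 2 * b (i + 1)) (fun i => b (i + 1))) := by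
      ext f g
      rcases f with ((f | f) | f) <;> rcases g with ((g | g) | g) <;>
        simp [e, lapAffine_cons, Matrix.diagonal_apply, apply_ite Neg.neg]
    have h₀ : lapAffine n (fun i => a i + b i) b +
        -Matrix.diagonal (fun h : Face n => b (fdim h)) = lapAffine n a b := by
      ext f g
      by_cases h : f = g <;> simp [lapAffine, Matrix.one_apply, h]
      ring
    have h₂ : lapAffine n (fun i => a i + b i) b -
        -Matrix.diagonal (fun h : Face n => b (fdim h)) =
          lapAffine n (fun i => a i + 2 * b i) b := by
      ext f g
      by_cases h : f = g <;> simp [lapAffine, Matrix.one_apply, h]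
      ring
    rw [← Matrix.det_submatrix_equiv_self e, he, Matrix.det_fromBlocks_zero₂₁,
      det_of_two_by_two_circulant, h₀, h₂, ih, ih, ih, prod_face_succ]
    simp only [fdim_cons, supp_cons]
    congr 1
    · congr 1
      · simp
      · refine Finset.prod_congr rfl fun f _ => ?_
        simp; ring
    · refine Finset.prod_congr rfl fun f _ => ?_
      simp [add_comm]; ring

/-- The total Laplacian of the `n`-cube on `k`-dimensional faces. -/
def lapDim (n k : ℕ) : Matrix (CFace n k) (CFace n k) ℤ :=
  (lap n).submatrix Subtype.val Subtype.val

theorem prod_supp (n k : ℕ) (w : ℕ → ℤ) :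
    ∏ f : Face n, (if fdim f = k then w (supp f) else 1) =
      ∏ l ∈ Finset.range (n + 1), w l ^ (n.choose l * l.choose k) := by
  induction n generalizing k w with
  | zero =>
    rw [Fintype.prod_subsingleton _ 0]
    cases k <;> simp [fdim, dir, supp]
  | succ n ih =>
    have h₂ : ∏ f : Face n, (if fdim (Fin.cons 2 f : Face (n + 1)) = k then
        w (supp (Fin.cons 2 f : Face (n + 1))) else 1) =
        ∏ l ∈ Finset.range (n + 1), w (l + 1) ^
          (n.choose l * (if k = 0 then 0 else l.choose (k - 1))) := by
      cases k with
      | zero => simp [fdim_cons]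
      | succ k =>
        simp only [fdim_cons, supp_cons, if_true, add_comm 1, add_left_inj]
        simpa [add_comm] using ih k fun l => w (l + 1)
    rw [prod_face_succ, h₂]
    simp only [fdim_cons, supp_cons]
    have h₀ := ih k w
    have h₁ := ih k fun l => w (l + 1)
    simp only [show (0 : Fin 3) ≠ 2 by decide, show (1 : Fin 3) ≠ 2 by decide,
      show (1 : Fin 3) ≠ 0 by decide, if_false, if_true, zero_add, add_comm 1 (supp _)]
    have h₃ : ∏ l ∈ Finset.range (n + 1), w l ^ (n.choose l * l.choose k) =
        ∏ l ∈ Finset.range (n + 2), w l ^ (n.choose l * l.choose k) := by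
      rw [Finset.prod_range_succ _ (n + 1)]
      simp
    rw [h₀, h₁, h₃, Finset.prod_range_succ', Finset.prod_range_succ' _ (n + 1),
      mul_right_comm _ (w 0 ^ _), mul_right_comm _ (w 0 ^ _), ← Finset.prod_mul_distrib,
      ← Finset.prod_mul_distrib]
    congr 1
    · refine Finset.prod_congr rfl fun l _ => ?_
      rw [← pow_add, ← pow_add]
      congr 1
      cases k with
      | zero => simp [Nat.choose_succ_succ, add_comm]
      | succ k => simp [Nat.choose_succ_succ]; ring
    · simp

theorem det_lapDim (n k : ℕ) :
    (lapDim n k).det = ∏ l ∈ Finset.range (n + 1), (2 * l : ℤ) ^ (n.choose l * l.choose k) := by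
  classical
  have h := det_lapAffine n (fun i => if i = k then 0 else 1) (fun i => if i = k then 1 else 0)
  rw [Matrix.twoBlockTriangular_det _ (fun f => fdim f = k)] at h
  · have h₁ : Matrix.toSquareBlockProp (lapAffine n (fun i => if i = k then 0 else 1)
        fun i => if i = k then 1 else 0) (fun f => fdim f = k) = lapDim n k := by
      ext f g
      simp [Matrix.toSquareBlockProp, lapAffine, lapDim, f.2]
    have h₂ : Matrix.toSquareBlockProp (lapAffine n (fun i => if i = k then 0 else 1)
        fun i => if i = k then 1 else 0) (fun f => ¬ fdim f = k) = 1 := by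
      ext f g
      simp [Matrix.toSquareBlockProp, lapAffine, f.2, Matrix.one_apply, Subtype.ext_iff]
    rw [h₁, h₂, Matrix.det_one, mul_one] at h
    rw [h, ← prod_supp n k fun l => 2 * l]
    refine Finset.prod_congr rfl fun f _ => ?_
    split_ifs <;> simp
  · intro f hf g hg
    have hfg : f ≠ g := by rintro rfl; exact hf hg
    simp [lapAffine, hf, hfg]

/-- A face is low if its first nonzero coordinate is `1`. -/
def IsLow {n : ℕ} (f : Face n) : Prop := ∃ i, f i = 1 ∧ ∀ j < i, f j = 0

instance {n : ℕ} : DecidablePred (IsLow (n := n)) := fun f => by unfold IsLow; infer_instance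

theorem isLow_cons {n : ℕ} (x : Fin 3) (f : Face n) :
    IsLow (Fin.cons x f : Face (n + 1)) ↔ x = 1 ∨ x = 0 ∧ IsLow f := by
  simp [IsLow, Fin.exists_fin_succ, Fin.forall_fin_succ, Fin.succ_lt_succ_iff]
  aesop

/-- The contraction of the `n`-cube onto the vertex `0`, as a map raising the dimension. -/
def cone : (n : ℕ) → Matrix (Face n) (Face n) ℤ
  | 0 => 0
  | n + 1 => Matrix.of fun g f =>
      if f 0 = 2 ∨ g 0 = 1 then 0
      else if g 0 = 0 then cone n (Fin.tail g) (Fin.tail f)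
      else if f 0 = 1 then (1 : Matrix (Face n) (Face n) ℤ) (Fin.tail g) (Fin.tail f) else 0

theorem cone_cons {n : ℕ} (x y : Fin 3) (g f : Face n) :
    cone (n + 1) (Fin.cons y g) (Fin.cons x f) =
      if x = 2 ∨ y = 1 then 0 else if y = 0 then cone n g f
      else if x = 1 then (1 : Matrix (Face n) (Face n) ℤ) g f else 0 := by
  rfl

theorem cone_apply_eq_zero {n : ℕ} (g f : Face n)
    (h : ¬ (IsLow f ∧ ¬ IsLow g ∧ fdim g = fdim f + 1)) : cone n g f = 0 := by
  induction n with
  | zero => rfl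
  | succ n ih =>
    obtain ⟨⟨x, f⟩, rfl⟩ := (Fin.consEquiv fun _ : Fin (n + 1) => Fin 3).surjective f
    obtain ⟨⟨y, g⟩, rfl⟩ := (Fin.consEquiv fun _ : Fin (n + 1) => Fin 3).surjective g
    have ih := ih g f
    simp only [Fin.consEquiv, Equiv.coe_fn_mk, fdim_cons, cone_cons, isLow_cons] at h ⊢
    by_cases hfg : f = g
    · subst hfg
      fin_cases x <;> fin_cases y <;> simp_all [add_comm]
    · rw [Matrix.one_apply_ne (Ne.symm hfg)]
      fin_cases x <;> fin_cases y <;> simp_all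

theorem cone_homotopy (n : ℕ) : bd n * cone n + cone n * bd n =
    1 - Matrix.of fun g f : Face n => if g = 0 ∧ fdim f = 0 then 1 else 0 := by
  induction n with
  | zero =>
    ext f g
    simp [cone, fdim, dir, Subsingleton.elim f g, Subsingleton.elim g 0]
  | succ n ih =>
    ext f g
    obtain ⟨⟨x, f⟩, rfl⟩ := (Fin.consEquiv fun _ : Fin (n + 1) => Fin 3).surjective f
    obtain ⟨⟨y, g⟩, rfl⟩ := (Fin.consEquiv fun _ : Fin (n + 1) => Fin 3).surjective g
    have h := congrFun (congrFun ih f) g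
    have h0 (x : Fin 3) : (Fin.cons x f : Face (n + 1)) = 0 ↔ x = 0 ∧ f = 0 := by
      simp [funext_iff, Fin.forall_fin_succ]
    have h1 : (Fin.cons x f : Face (n + 1)) = Fin.cons y g ↔ x = y ∧ f = g := Fin.cons_inj
    simp only [Matrix.add_apply, Matrix.sub_apply, Matrix.mul_apply, Matrix.of_apply] at h
    simp only [Fin.consEquiv, Equiv.coe_fn_mk, Matrix.mul_apply, Matrix.add_apply,
      Matrix.sub_apply, sum_face_succ, bd_cons, cone_cons, Matrix.of_apply, fdim_cons, h0,
      Matrix.one_apply, h1]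
    rw [Matrix.one_apply] at h
    fin_cases x <;> fin_cases y <;> simp <;> linarith

/-! ### Determinants -/

section Determinants

variable {a b c d u : Type*} [Fintype a] [DecidableEq a] [Fintype b] [DecidableEq b]
  [Fintype c] [DecidableEq c] [Fintype d] [DecidableEq d] [Fintype u] [DecidableEq u]

theorem det_mul_mul_transpose_of_unimodular (W : Matrix d u ℤ) (H : Matrix u d ℤ)
    (hWH : W * H = 1) (hHW : H * W = 1) (X : Matrix u u ℤ) : (W * X * Wᵀ).det = X.det := by
  obtain ⟨e⟩ : Nonempty (d ≃ u) :=
    ⟨Fintype.equivOfCardEq (Matrix.square_of_invertible W H hWH hHW)⟩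
  have h₁ : W * X * Wᵀ =
      W.submatrix id e * X.submatrix e e * (W.submatrix id e)ᵀ := by
    simp [Matrix.transpose_submatrix, Matrix.submatrix_mul_equiv]
  have h₂ : W.submatrix id e * H.submatrix e id = 1 := by
    rw [Matrix.submatrix_mul_equiv, hWH, Matrix.submatrix_id_id]
  have h₃ : (W.submatrix id e).det * (W.submatrix id e).det = 1 := by
    have := congrArg Matrix.det h₂
    rw [Matrix.det_mul, Matrix.det_one] at this
    rcases Int.mul_eq_one_iff_eq_one_or_neg_one.1 this with h | h <;> rw [h.1] <;> rfl
  rw [h₁, Matrix.det_mul, Matrix.det_mul, Matrix.det_transpose, mul_right_comm, h₃, one_mul,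
    Matrix.det_submatrix_equiv_self]

theorem det_add_eq_det_one_add (A : Matrix d a ℤ) (B : Matrix u a ℤ) (W : Matrix d u ℤ)
    (H : Matrix u d ℤ) (hWH : W * H = 1) (hHW : H * W = 1) (h : A + W * B = 0) :
    (A * Aᵀ + W * Wᵀ).det = (1 + Bᵀ * B).det := by
  rw [eq_neg_of_add_eq_zero_left h, Matrix.det_one_add_mul_comm,
    ← det_mul_mul_transpose_of_unimodular W H hWH hHW (1 + B * Bᵀ)]
  congr 1
  simp [Matrix.mul_add, Matrix.add_mul, Matrix.mul_assoc, add_comm]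

theorem det_add_of_mul_eq_zero (e : c ≃ a ⊕ b) (V : Matrix c a ℤ) (M : Matrix b c ℤ)
    (P : Matrix a a ℤ) (Q : Matrix b b ℤ) (h : M * V = 0) :
    (V * P * Vᵀ + Mᵀ * Q * M).det = P.det * Q.det * ((Vᵀ * V).det * (M * Mᵀ).det) := by
  set G : Matrix c (a ⊕ b) ℤ := Matrix.fromCols V Mᵀ with hG
  have h₁ : V * P * Vᵀ + Mᵀ * Q * M = G * Matrix.fromBlocks P 0 0 Q * Gᵀ := by
    simp [hG, Matrix.fromCols_mul_fromBlocks, Matrix.transpose_fromCols,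
      Matrix.fromCols_mul_fromRows]
  have h₂ : Gᵀ * G = Matrix.fromBlocks (Vᵀ * V) 0 0 (M * Mᵀ) := by
    have h' : Vᵀ * Mᵀ = 0 := by rw [← Matrix.transpose_mul, h, Matrix.transpose_zero]
    simp [hG, Matrix.transpose_fromCols, h, h']
  set G' : Matrix c c ℤ := G.submatrix id e
  have h₃ : G'.det * G'.det = (Vᵀ * V).det * (M * Mᵀ).det := by
    have := Matrix.det_submatrix_equiv_self e (Gᵀ * G)
    rw [← Matrix.submatrix_mul_equiv _ _ e (Equiv.refl c) e, Matrix.det_mul, h₂,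
      Matrix.det_fromBlocks_zero₂₁, ← Matrix.det_transpose] at this
    exact this
  have h₄ : G * Matrix.fromBlocks P 0 0 Q * Gᵀ =
      G' * (Matrix.fromBlocks P 0 0 Q).submatrix e e * G'ᵀ := by
    simp [G', Matrix.transpose_submatrix, Matrix.submatrix_mul_equiv]
  rw [h₁, h₄, Matrix.det_mul, Matrix.det_mul, Matrix.det_transpose,
    Matrix.det_submatrix_equiv_self, Matrix.det_fromBlocks_zero₂₁, ← h₃]
  ring

/-- The **Cauchy–Binet formula**. -/
theorem det_mul_eq_sum_subsets {R : Type*} [CommRing R] (M : Matrix d c R) (N : Matrix c d R)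
    (e : ∀ T : {T : Finset c // T.card = Fintype.card d}, d ≃ T.1) :
    (M * N).det = ∑ T : {T : Finset c // T.card = Fintype.card d},
      (M.submatrix id fun i => (e T i : c)).det * (N.submatrix (fun i => (e T i : c)) id).det := by
  have h₁ : (M * N).det = ∑ p : d → c, (M.submatrix id p).det * ∏ i, N (p i) i := by
    simp only [Matrix.det_apply', Matrix.mul_apply, Finset.prod_univ_sum, Finset.mul_sum,
      Fintype.piFinset_univ, Finset.sum_mul, Matrix.submatrix_apply, id]
    rw [Finset.sum_comm]
    simp only [Finset.prod_mul_distrib, mul_assoc]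
  have h₂ (p : d → c) (hp : ¬ Function.Injective p) : (M.submatrix id p).det = 0 := by
    simp only [Function.Injective, not_forall] at hp
    obtain ⟨i, j, hij, hne⟩ := hp
    exact Matrix.det_zero_of_column_eq hne fun k => by simp [hij]
  have h₃ (T : {T : Finset c // T.card = Fintype.card d}) :
      (M.submatrix id fun i => (e T i : c)).det * (N.submatrix (fun i => (e T i : c)) id).det =
        ∑ σ : Equiv.Perm d, (M.submatrix id fun i => (e T (σ i) : c)).det *
          ∏ i, N (e T (σ i)) i := by
    rw [Matrix.det_apply' (N.submatrix _ _), Finset.mul_sum]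
    refine Finset.sum_congr rfl fun σ _ => ?_
    have := Matrix.det_permute' σ (M.submatrix id fun i => (e T i : c))
    rw [Matrix.submatrix_submatrix] at this
    simp only [Function.comp_def, id] at this
    erw [this]
    simp only [Matrix.submatrix_apply, id]
    ring
  rw [h₁, ← Finset.sum_subset (Finset.subset_univ
    (Finset.univ.filter fun p : d → c => Function.Injective p))
    (fun p _ hp => by rw [h₂ p (by simpa using hp), zero_mul]),
    Finset.sum_congr rfl fun T _ => h₃ T,
    ← Finset.sum_product', Finset.univ_product_univ]
  symm
  refine Finset.sum_bij (fun x _ i => (e x.1 (x.2 i) : c)) ?_ ?_ ?_ ?_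
  · intro x _
    rw [Finset.mem_filter]
    exact ⟨Finset.mem_univ _, Subtype.val_injective.comp ((e x.1).injective.comp x.2.injective)⟩
  · rintro ⟨T, σ⟩ _ ⟨T', σ'⟩ _ h
    have hT (T : {T : Finset c // T.card = Fintype.card d}) (σ : Equiv.Perm d) :
        Finset.univ.image (fun i => (e T (σ i) : c)) = T.1 := by
      ext x
      simp only [Finset.mem_image, Finset.mem_univ, true_and]
      refine ⟨?_, fun hx => ⟨σ.symm ((e T).symm ⟨x, hx⟩), by simp⟩⟩
      rintro ⟨i, rfl⟩
      exact (e T (σ i)).2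
    obtain rfl : T = T' := by
      refine Subtype.ext ?_
      rw [← hT T σ, ← hT T' σ']
      exact congrArg (Finset.univ.image ·) h
    congr 1
    ext i
    exact (e T).injective (Subtype.ext (congrFun h i))
  · intro p hp
    have hp : Function.Injective p := by simpa using hp
    let T : {T : Finset c // T.card = Fintype.card d} :=
      ⟨Finset.univ.image p, by rw [Finset.card_image_of_injective _ hp, Finset.card_univ]⟩
    let q : d ≃ T.1 := Equiv.ofBijective (fun i => ⟨p i, by simp [T]⟩)
      ⟨fun i j h => hp (congrArg Subtype.val h), fun ⟨x, hx⟩ => by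
        obtain ⟨i, -, rfl⟩ := Finset.mem_image.1 hx
        exact ⟨i, rfl⟩⟩
    exact ⟨(T, q.trans (e T).symm), Finset.mem_univ _, by
      ext i
      simp only [Equiv.trans_apply, Equiv.apply_symm_apply]
      rfl⟩
  · intro x _
    rfl

end Determinants

/-! ### The chain complex in a fixed dimension -/

/-- The low `k`-dimensional faces of the `n`-cube. -/
abbrev LowFace (n k : ℕ) : Type := {f : CFace n k // IsLow f.1}

theorem sum_cFace {n : ℕ} (k : ℕ) (F : Face n → ℤ) (h : ∀ f, fdim f ≠ k → F f = 0) :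
    ∑ f : CFace n k, F f = ∑ f, F f := by
  rw [← Finset.sum_subset (Finset.subset_univ (Finset.univ.filter fun f : Face n => fdim f = k))
    fun f _ hf => h f (by simpa using hf)]
  exact (Finset.sum_subtype _ (by simp) F).symm

/-- The contraction of the `n`-cube on `k`-dimensional faces. -/
def coneDim (n k : ℕ) : Matrix (CFace n (k + 1)) (CFace n k) ℤ :=
  (cone n).submatrix Subtype.val Subtype.val

theorem bdZ_mul_bdZ (n k : ℕ) : bdZ n k * bdZ n (k + 1) = 0 := by
  ext f g
  have h := congrFun (congrFun (bd_mul_bd n) f) g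
  simp only [Matrix.mul_apply] at h ⊢
  refine (sum_cFace _ (fun x => bd n f x * bd n x g) fun x hx => ?_).trans h
  rw [bd_apply_eq_zero f.1 x (by rw [f.2]; exact hx), zero_mul]

theorem bdZ_mul_coneDim_add (n k : ℕ) :
    bdZ n (k + 1) * coneDim n (k + 1) + coneDim n k * bdZ n k = 1 := by
  ext f g
  have h := congrFun (congrFun (cone_homotopy n) f) g
  simp only [Matrix.mul_apply, Matrix.add_apply, Matrix.sub_apply, Matrix.of_apply, g.2,
    Nat.add_one_ne_zero, and_false, if_false, sub_zero] at h ⊢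
  rw [Matrix.one_apply] at h ⊢
  simp only [Subtype.ext_iff]
  rw [← h]
  congr 1
  · refine sum_cFace _ (fun x => bd n f x * cone n x g) fun x hx => ?_
    rw [bd_apply_eq_zero f.1 x (by rw [f.2]; exact hx), zero_mul]
  · refine sum_cFace _ (fun x => cone n f x * bd n x g) fun x hx => ?_
    rw [bd_apply_eq_zero x g.1 (by rw [g.2]; omega), mul_zero]

theorem bdZ_mul_coneDim_zero (n : ℕ) :
    bdZ n 0 * coneDim n 0 = 1 - Matrix.of fun f _ => if f.1 = 0 then 1 else 0 := by
  ext f g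
  have h := congrFun (congrFun (cone_homotopy n) f) g
  have h0 (x : Face n) : bd n x g = 0 := bd_apply_eq_zero _ _ (by rw [g.2]; omega)
  simp only [Matrix.mul_apply, Matrix.add_apply, Matrix.sub_apply, Matrix.of_apply, g.2,
    and_true, h0, mul_zero, Finset.sum_const_zero, add_zero] at h ⊢
  rw [Matrix.one_apply] at h ⊢
  simp only [Subtype.ext_iff]
  rw [← h]
  refine sum_cFace _ (fun x => bd n f x * cone n x g) fun x hx => ?_
  rw [bd_apply_eq_zero f.1 x (by rw [f.2]; exact hx), zero_mul]

theorem lapDim_succ (n k : ℕ) : lapDim n (k + 1) =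
    bdZ n (k + 1) * (bdZ n (k + 1))ᵀ + (bdZ n k)ᵀ * bdZ n k := by
  ext f g
  simp only [lapDim, lap, Matrix.submatrix_apply, Matrix.add_apply, Matrix.mul_apply,
    Matrix.transpose_apply]
  congr 1 <;> symm
  · refine sum_cFace _ (fun x => bd n f x * bd n g x) fun x hx => ?_
    rw [bd_apply_eq_zero f.1 x (by rw [f.2]; exact hx), zero_mul]
  · refine sum_cFace _ (fun x => bd n x f * bd n x g) fun x hx => ?_
    rw [bd_apply_eq_zero x g.1 (by rw [g.2]; omega), mul_zero]

theorem coneDim_apply_of_not_isLow {n k : ℕ} (g : CFace n (k + 1)) (f : CFace n k)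
    (h : ¬ IsLow f.1) : coneDim n k g f = 0 :=
  cone_apply_eq_zero _ _ fun h' => h h'.1

theorem coneDim_apply_of_isLow {n k : ℕ} (g : CFace n (k + 1)) (f : CFace n k)
    (h : IsLow g.1) : coneDim n k g f = 0 :=
  cone_apply_eq_zero _ _ fun h' => h'.2.1 h

/-- The rows of the boundary matrix indexed by low faces. -/
def bdLow (n k : ℕ) : Matrix (LowFace n k) (CFace n (k + 1)) ℤ :=
  (bdZ n k).submatrix Subtype.val id

/-- The basis of the reduced cycles which is dual to the low faces. -/
def cyc (n k : ℕ) : Matrix (CFace n k) (LowFace n k) ℤ :=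
  (bdZ n k * coneDim n k).submatrix id Subtype.val

theorem bdZ_mul_coneDim_mul_bdZ (n k : ℕ) : bdZ n k * coneDim n k * bdZ n k = bdZ n k := by
  have h := congrArg (bdZ n k * ·) (bdZ_mul_coneDim_add n k)
  simpa [Matrix.mul_add, ← Matrix.mul_assoc, bdZ_mul_bdZ] using h

theorem sum_lowFace {n k : ℕ} {R : Type*} [AddCommMonoid R] (F : CFace n k → R)
    (h : ∀ f, ¬ IsLow f.1 → F f = 0) : ∑ f : LowFace n k, F f = ∑ f, F f := by
  rw [← Finset.sum_subset (Finset.subset_univ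
    (Finset.univ.filter fun f : CFace n k => IsLow f.1)) fun f _ hf => h f (by simpa using hf)]
  exact (Finset.sum_subtype _ (by simp) F).symm

theorem bdZ_mul_coneDim_apply_eq_zero {n k : ℕ} (g f : CFace n k) (h : ¬ IsLow f.1) :
    (bdZ n k * coneDim n k) g f = 0 := by
  simp [Matrix.mul_apply, coneDim_apply_of_not_isLow _ f h]

theorem bdZ_mul_cyc (n k : ℕ) : bdZ n k * cyc n (k + 1) = 0 := by
  have : bdZ n k * cyc n (k + 1) =
      (bdZ n k * bdZ n (k + 1) * coneDim n (k + 1)).submatrix id Subtype.val := by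
    rw [Matrix.mul_assoc]
    rfl
  rw [this, bdZ_mul_bdZ, Matrix.zero_mul]
  rfl

theorem bdLow_mul_cyc (n k : ℕ) : bdLow n k * cyc n (k + 1) = 0 := by
  ext f g
  exact congrFun (congrFun (bdZ_mul_cyc n k) f) g

theorem cyc_mul_bdLow (n k : ℕ) : cyc n k * bdLow n k = bdZ n k := by
  ext f g
  conv_rhs => rw [← bdZ_mul_coneDim_mul_bdZ, Matrix.mul_apply]
  rw [Matrix.mul_apply]
  exact sum_lowFace (fun x => (bdZ n k * coneDim n k) f x * bdZ n k x g) fun x hx => by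
    rw [bdZ_mul_coneDim_apply_eq_zero _ _ hx, zero_mul]

theorem not_isLow_zero {n : ℕ} : ¬ IsLow (0 : Face n) := by
  rintro ⟨i, hi, -⟩
  simp at hi

theorem cyc_low (n k : ℕ) :
    (cyc n k).submatrix (Subtype.val : LowFace n k → CFace n k) id = 1 := by
  ext f g
  rw [Matrix.submatrix_apply, id, cyc, Matrix.submatrix_apply, id]
  have h1 : (1 : Matrix (LowFace n k) (LowFace n k) ℤ) f g =
      (1 : Matrix (CFace n k) (CFace n k) ℤ) f g := by
    simp [Matrix.one_apply, Subtype.ext_iff]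
  rw [h1]
  cases k with
  | zero =>
    have h0 : f.1.1 ≠ 0 := fun h => not_isLow_zero (h ▸ f.2)
    rw [bdZ_mul_coneDim_zero]
    simp [h0]
  | succ k =>
    rw [eq_sub_of_add_eq (bdZ_mul_coneDim_add n k), Matrix.sub_apply, Matrix.mul_apply,
      Finset.sum_eq_zero, sub_zero]
    intro x _
    rw [coneDim_apply_of_isLow _ _ f.2, zero_mul]

/-- The `k`-dimensional faces of the `n`-cube that are not low. -/
abbrev HighFace (n k : ℕ) : Type := {f : CFace n k // ¬ IsLow f.1}

theorem sum_highFace {n k : ℕ} {R : Type*} [AddCommMonoid R] (F : CFace n k → R)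
    (h : ∀ f, IsLow f.1 → F f = 0) : ∑ f : HighFace n k, F f = ∑ f, F f := by
  rw [← Finset.sum_subset (Finset.subset_univ
    (Finset.univ.filter fun f : CFace n k => ¬ IsLow f.1)) fun f _ hf => h f (by simpa using hf)]
  exact (Finset.sum_subtype _ (by simp) F).symm

/-- The square block of the boundary matrix formed by low rows and high columns. -/
def bdBlock (n k : ℕ) : Matrix (LowFace n k) (HighFace n (k + 1)) ℤ :=
  (bdZ n k).submatrix Subtype.val Subtype.val

/-- The inverse of `bdBlock`. -/
def coneBlock (n k : ℕ) : Matrix (HighFace n (k + 1)) (LowFace n k) ℤ :=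
  (coneDim n k).submatrix Subtype.val Subtype.val

theorem bdBlock_mul_coneBlock (n k : ℕ) : bdBlock n k * coneBlock n k = 1 := by
  rw [← cyc_low n k]
  ext f g
  simp only [bdBlock, coneBlock, cyc, Matrix.mul_apply, Matrix.submatrix_apply, id]
  exact sum_highFace (fun x => bdZ n k f x * coneDim n k x g) fun x hx => by
    rw [coneDim_apply_of_isLow _ _ hx, mul_zero]

theorem coneBlock_mul_bdBlock (n k : ℕ) : coneBlock n k * bdBlock n k = 1 := by
  ext f g
  have h := congrFun (congrFun (bdZ_mul_coneDim_add n k) f) g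
  rw [Matrix.add_apply, bdZ_mul_coneDim_apply_eq_zero _ _ g.2, zero_add] at h
  have h1 : (1 : Matrix (HighFace n (k + 1)) (HighFace n (k + 1)) ℤ) f g =
      (1 : Matrix (CFace n (k + 1)) (CFace n (k + 1)) ℤ) f g := by
    simp [Matrix.one_apply, Subtype.ext_iff]
  rw [h1, ← h]
  exact sum_lowFace (fun x => coneDim n k f x * bdZ n k x g) fun x hx => by
    rw [coneDim_apply_of_not_isLow _ _ hx, zero_mul]

/-- The determinant of the Laplacian reduced to the low faces. -/
def lowDet (n k : ℕ) : ℤ := (bdLow n k * (bdLow n k)ᵀ).det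

theorem sum_low_add_sum_high {n k : ℕ} (F : CFace n k → ℤ) :
    ∑ f : LowFace n k, F f + ∑ f : HighFace n k, F f = ∑ f, F f :=
  Fintype.sum_subtype_add_sum_subtype _ F

theorem det_transpose_cyc_mul_cyc (n k : ℕ) :
    ((cyc n (k + 1))ᵀ * cyc n (k + 1)).det = lowDet n k := by
  set A : Matrix (LowFace n k) (LowFace n (k + 1)) ℤ := (bdLow n k).submatrix id Subtype.val
  set B : Matrix (HighFace n (k + 1)) (LowFace n (k + 1)) ℤ :=
    (cyc n (k + 1)).submatrix Subtype.val id
  have hc (f g : LowFace n (k + 1)) : cyc n (k + 1) f g = (1 : Matrix _ _ ℤ) f g :=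
    congrFun (congrFun (cyc_low n (k + 1)) f) g
  have h₁ : bdLow n k * (bdLow n k)ᵀ = A * Aᵀ + bdBlock n k * (bdBlock n k)ᵀ := by
    ext f g
    simp only [Matrix.add_apply, Matrix.mul_apply, ← sum_low_add_sum_high]
    rfl
  have h₂ : (cyc n (k + 1))ᵀ * cyc n (k + 1) = 1 + Bᵀ * B := by
    rw [← Matrix.one_mul (1 : Matrix (LowFace n (k + 1)) (LowFace n (k + 1)) ℤ)]
    ext f g
    simp only [Matrix.add_apply, Matrix.mul_apply, ← sum_low_add_sum_high, Matrix.transpose_apply,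
      hc]
    congr 1
    refine Finset.sum_congr rfl fun x _ => ?_
    rw [← Matrix.transpose_apply (1 : Matrix (LowFace n (k + 1)) (LowFace n (k + 1)) ℤ),
      Matrix.transpose_one]
  have h₃ : A + bdBlock n k * B = 0 := by
    rw [← bdLow_mul_cyc n k, ← Matrix.mul_one A]
    ext f g
    simp only [Matrix.add_apply, Matrix.mul_apply, ← sum_low_add_sum_high, hc]
    rfl
  rw [lowDet, h₁, h₂, det_add_eq_det_one_add A B _ _ (bdBlock_mul_coneBlock n k)
    (coneBlock_mul_bdBlock n k) h₃]

theorem det_lapDim_eq_lowDet (n k : ℕ) :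
    (lapDim n (k + 2)).det = lowDet n (k + 2) * lowDet n (k + 1) ^ 2 * lowDet n k := by
  have hcard := Matrix.square_of_invertible _ _ (bdBlock_mul_coneBlock n (k + 1))
    (coneBlock_mul_bdBlock n (k + 1))
  let e : CFace n (k + 2) ≃ LowFace n (k + 2) ⊕ LowFace n (k + 1) :=
    (Equiv.sumCompl fun f : CFace n (k + 2) => IsLow f.1).symm.trans
      (Equiv.sumCongr (Equiv.refl _) (Fintype.equivOfCardEq hcard.symm))
  have h : lapDim n (k + 2) =
      cyc n (k + 2) * (bdLow n (k + 2) * (bdLow n (k + 2))ᵀ) * (cyc n (k + 2))ᵀ +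
        (bdLow n (k + 1))ᵀ * ((cyc n (k + 1))ᵀ * cyc n (k + 1)) * bdLow n (k + 1) := by
    rw [lapDim_succ, ← cyc_mul_bdLow n (k + 2), ← cyc_mul_bdLow n (k + 1)]
    simp only [Matrix.transpose_mul, Matrix.mul_assoc]
  rw [h, det_add_of_mul_eq_zero e _ _ _ _ (bdLow_mul_cyc n (k + 1)),
    det_transpose_cyc_mul_cyc, det_transpose_cyc_mul_cyc]
  simp only [lowDet]
  ring

theorem lowDet_eq_one (n k : ℕ) (h : n ≤ k) : lowDet n k = 1 := by
  have : IsEmpty (LowFace n k) := by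
    refine ⟨?_⟩
    rintro ⟨⟨f, hf⟩, i, hi, -⟩
    replace hi : f i = 1 := hi
    have : fdim f < n := by
      have := Finset.card_lt_univ_of_notMem (s := dir f) (x := i) (by simp [dir, hi])
      rwa [Fintype.card_fin] at this
    omega
  exact Matrix.det_isEmpty

theorem lowDet_eq (n k : ℕ) :
    lowDet n k = ∏ l ∈ Finset.Icc 2 n, (2 * l : ℤ) ^ (n.choose l * (l - 2).choose k) := by
  have hbase (k : ℕ) (hk : n ≤ k) :
      ∏ l ∈ Finset.Icc 2 n, (2 * l : ℤ) ^ (n.choose l * (l - 2).choose k) = 1 := by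
    refine Finset.prod_eq_one fun l hl => ?_
    rw [Finset.mem_Icc] at hl
    rw [Nat.choose_eq_zero_of_lt (show l - 2 < k by omega), mul_zero, pow_zero]
  have hne (k : ℕ) :
      ∏ l ∈ Finset.Icc 2 n, (2 * l : ℤ) ^ (n.choose l * (l - 2).choose k) ≠ 0 := by
    refine Finset.prod_ne_zero_iff.2 fun l hl => pow_ne_zero _ ?_
    rw [Finset.mem_Icc] at hl
    omega
  induction hm : n - k using Nat.strong_induction_on generalizing k with
  | _ m ih =>
    by_cases hk : n ≤ k
    · rw [lowDet_eq_one n k hk, hbase k hk]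
    · have h := det_lapDim_eq_lowDet n k
      rw [ih (n - (k + 1)) (by omega) (k + 1) rfl] at h
      rw [show lowDet n (k + 2) = _ from if hk' : n ≤ k + 2 then
        (lowDet_eq_one n _ hk').trans (hbase _ hk').symm else
        ih (n - (k + 2)) (by omega) (k + 2) rfl, det_lapDim] at h
      refine mul_left_cancel₀ (mul_ne_zero (hne (k + 2)) (pow_ne_zero 2 (hne (k + 1)))) ?_
      rw [← h, ← Finset.prod_pow, ← Finset.prod_mul_distrib, ← Finset.prod_mul_distrib]
      rw [← Finset.prod_subset (s₁ := Finset.Icc 2 n)]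
      · refine Finset.prod_congr rfl fun l hl => ?_
        obtain ⟨l, rfl⟩ := Nat.exists_eq_add_of_le' (Finset.mem_Icc.1 hl).1
        rw [← pow_mul, ← pow_add, ← pow_add]
        congr 1
        simp only [Nat.add_sub_cancel, Nat.choose_succ_succ]
        ring
      · intro l hl
        simp only [Finset.mem_Icc, Finset.mem_range] at *
        omega
      · intro l hl hl'
        simp only [Finset.mem_Icc, Finset.mem_range] at *
        rw [Nat.choose_eq_zero_of_lt (show l < k + 2 by omega), mul_zero, pow_zero]

/-! ### Coordinates on the reduced cycles -/

/-- A submodule of `c → R` spanned by the columns of a matrix which is the identity on the rows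
`ι` is coordinatised by these rows. -/
def rowCoords {R c d : Type*} [CommRing R] [Fintype d] [DecidableEq d] (V : Matrix c d R)
    (ι : d → c) (Z : Submodule R (c → R)) (hV : V.submatrix ι id = 1) (hmem : ∀ y, V *ᵥ y ∈ Z)
    (hZ : ∀ z ∈ Z, V *ᵥ (z ∘ ι) = z) : Z ≃ₗ[R] (d → R) where
  toFun z := z.1 ∘ ι
  map_add' _ _ := rfl
  map_smul' _ _ := rfl
  invFun y := ⟨V *ᵥ y, hmem y⟩
  left_inv z := Subtype.ext (hZ z.1 z.2)
  right_inv y := (congrArg (· *ᵥ y) hV).trans (Matrix.one_mulVec y)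

theorem sum_bdZ_mul_coneDim_zero (n : ℕ) (g : CFace n 0) :
    ∑ f, (bdZ n 0 * coneDim n 0) f g = 0 := by
  have h0 : fdim (0 : Face n) = 0 := by simp [fdim, dir]
  have h (f : CFace n 0) : f.1 = 0 ↔ f = ⟨0, h0⟩ := by rw [Subtype.ext_iff]
  simp [bdZ_mul_coneDim_zero, Matrix.one_apply, h]

theorem sum_cyc_zero (n : ℕ) (g : LowFace n 0) : ∑ f, cyc n 0 f g = 0 :=
  sum_bdZ_mul_coneDim_zero n g

section

variable {R : Type*} [CommRing R]

theorem cyc_mulVec_restrict {n k : ℕ} (z : CFace n k → R) :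
    (cyc n k).map (Int.cast : ℤ → R) *ᵥ (fun f : LowFace n k => z f) =
      (bdZ n k * coneDim n k).map (Int.cast : ℤ → R) *ᵥ z := by
  ext f
  exact sum_lowFace (fun x => ((bdZ n k * coneDim n k) f x : R) * z x) fun x hx => by
    rw [bdZ_mul_coneDim_apply_eq_zero _ _ hx, Int.cast_zero, zero_mul]

theorem cyc_mulVec_restrict_zero {n : ℕ} (z : CFace n 0 → R) (hz : ∑ f, z f = 0) :
    (cyc n 0).map (Int.cast : ℤ → R) *ᵥ (fun f : LowFace n 0 => z f) = z := by
  rw [cyc_mulVec_restrict]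
  ext f
  simp [bdZ_mul_coneDim_zero, Matrix.mulVec, dotProduct, Matrix.one_apply, sub_mul,
    Finset.sum_sub_distrib, hz]

theorem cyc_mulVec_restrict_succ {n k : ℕ} (z : CFace n (k + 1) → R)
    (hz : (bdZ n k).map (Int.cast : ℤ → R) *ᵥ z = 0) :
    (cyc n (k + 1)).map (Int.cast : ℤ → R) *ᵥ (fun f : LowFace n (k + 1) => z f) = z := by
  rw [cyc_mulVec_restrict, eq_sub_of_add_eq (bdZ_mul_coneDim_add n k)]
  have h : (1 - coneDim n k * bdZ n k).map (Int.cast : ℤ → R) =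
      1 - (coneDim n k).map (Int.cast : ℤ → R) * (bdZ n k).map (Int.cast : ℤ → R) := by
    have := map_sub (Int.castRingHom R).mapMatrix 1 (coneDim n k * bdZ n k)
    rw [map_one] at this
    refine this.trans (congrArg (1 - ·) ?_)
    exact Matrix.map_mul (f := Int.castRingHom R)
  rw [h, Matrix.sub_mulVec, ← Matrix.mulVec_mulVec, hz, Matrix.mulVec_zero, Matrix.one_mulVec,
    sub_zero]

theorem sum_cyc_mulVec_zero {n : ℕ} (y : LowFace n 0 → R) :
    ∑ f, ((cyc n 0).map (Int.cast : ℤ → R) *ᵥ y) f = 0 := by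
  simp only [Matrix.mulVec, dotProduct, Matrix.map_apply]
  rw [Finset.sum_comm]
  refine Finset.sum_eq_zero fun g _ => ?_
  rw [← Finset.sum_mul, ← Int.cast_sum, sum_cyc_zero, Int.cast_zero, zero_mul]

theorem bdZ_mulVec_cyc_mulVec {n k : ℕ} (y : LowFace n (k + 1) → R) :
    (bdZ n k).map (Int.cast : ℤ → R) *ᵥ ((cyc n (k + 1)).map (Int.cast : ℤ → R) *ᵥ y) = 0 := by
  rw [Matrix.mulVec_mulVec]
  have h : (bdZ n k).map (Int.cast : ℤ → R) * (cyc n (k + 1)).map (Int.cast : ℤ → R) =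
      (bdZ n k * cyc n (k + 1)).map (Int.cast : ℤ → R) :=
    (Matrix.map_mul (f := Int.castRingHom R)).symm
  rw [h, bdZ_mul_cyc]
  simp

theorem cyc_map_low (n k : ℕ) : ((cyc n k).map (Int.cast : ℤ → R)).submatrix
    (Subtype.val : LowFace n k → CFace n k) id = 1 := by
  rw [Matrix.submatrix_map, cyc_low]
  exact Matrix.map_one _ Int.cast_zero Int.cast_one

end

theorem cyc_mulVec_mem (n k : ℕ) (y : LowFace n k → ℤ) : cyc n k *ᵥ y ∈ ZkerC n k := by
  cases k with
  | zero => exact sum_cyc_mulVec_zero (R := ℤ) y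
  | succ k => exact bdZ_mulVec_cyc_mulVec (R := ℤ) y

theorem cyc_mulVec_restrict_of_mem {n k : ℕ} (z : CFace n k → ℤ) (hz : z ∈ ZkerC n k) :
    cyc n k *ᵥ (z ∘ Subtype.val) = z := by
  cases k with
  | zero => exact cyc_mulVec_restrict_zero z hz
  | succ k => exact cyc_mulVec_restrict_succ z hz

/-- The coordinates of a reduced cycle on the low faces. -/
def zkerCoords (n k : ℕ) : ZkerC n k ≃ₗ[ℤ] (LowFace n k → ℤ) :=
  rowCoords (cyc n k) Subtype.val _ (cyc_low n k) (cyc_mulVec_mem n k) cyc_mulVec_restrict_of_mem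

open Classical in
theorem finrank_zkerCQ (n k : ℕ) :
    Module.finrank ℚ (ZkerCQ n k) = Fintype.card (LowFace n k) := by
  have e : ZkerCQ n k ≃ₗ[ℚ] (LowFace n k → ℚ) := by
    refine rowCoords _ Subtype.val _ (cyc_map_low n k) ?_ ?_
    · cases k with
      | zero => exact sum_cyc_mulVec_zero
      | succ k => exact bdZ_mulVec_cyc_mulVec
    · cases k with
      | zero => exact cyc_mulVec_restrict_zero
      | succ k => exact cyc_mulVec_restrict_succ
  rw [e.finrank_eq, Module.finrank_fintype_fun_eq_card]

theorem card_quotient_span_rows {d : Type*} [Fintype d] [DecidableEq d] (A : Matrix d d ℤ)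
    (hA : A.det ≠ 0) :
    Nat.card ((d → ℤ) ⧸ Submodule.span ℤ (Set.range A)) = A.det.natAbs := by
  have hli : LinearIndependent ℤ A := Matrix.linearIndependent_rows_of_det_ne_zero hA
  rw [← Submodule.natAbs_det_basis_change (Pi.basisFun ℤ d) _ (Module.Basis.span hli),
    Pi.basisFun_det_apply]
  congr 2
  ext i j
  exact congrFun (congrArg Subtype.val (Module.Basis.span_apply hli i)) j

theorem linearIndependent_iff_det_ne_zero {d : Type*} [Fintype d] [DecidableEq d]
    (A : Matrix d d ℤ) : LinearIndependent ℤ A ↔ A.det ≠ 0 := by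
  refine ⟨fun h h0 => ?_, Matrix.linearIndependent_rows_of_det_ne_zero⟩
  obtain ⟨v, hv, hv0⟩ := Matrix.exists_vecMul_eq_zero_iff.2 h0
  refine hv (Matrix.vecMul_injective_iff.2 h ?_)
  simpa using hv0

theorem bdZ_col_eq (n j : ℕ) (t : CFace n (j + 1)) :
    (bdZ n j)ᵀ t = cyc n j *ᵥ (bdLow n j)ᵀ t := by
  rw [← cyc_mul_bdLow]
  rfl

theorem colSpanC_le (n j : ℕ) (T : Finset (CFace n (j + 1))) : colSpanC n j T ≤ ZkerC n j := by
  rw [colSpanC, Submodule.span_le]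
  rintro _ ⟨t, -, rfl⟩
  simp only [bdZ_col_eq]
  exact cyc_mulVec_mem n j _

theorem linearIndependent_bdZ_col_iff {n j : ℕ} {S : Type*} (s : S → CFace n (j + 1)) :
    LinearIndependent ℤ (fun t => (bdZ n j)ᵀ (s t)) ↔
      LinearIndependent ℤ (fun t => (bdLow n j)ᵀ (s t)) := by
  constructor <;> intro h
  · refine LinearIndependent.of_comp (cyc n j).mulVecLin ?_
    exact (funext fun t => bdZ_col_eq n j (s t) :
      (fun t => (bdZ n j)ᵀ (s t)) = (cyc n j).mulVecLin ∘ fun t => (bdLow n j)ᵀ (s t)) ▸ h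
  · exact LinearIndependent.of_comp (LinearMap.funLeft ℤ ℤ Subtype.val) h

theorem card_hsubC {n j : ℕ} (T : Finset (CFace n (j + 1))) :
    Nat.card (HsubC n j T) = Nat.card ((LowFace n j → ℤ) ⧸
      Submodule.span ℤ (Set.range fun t : {f // f ∈ T} => (bdLow n j)ᵀ t)) := by
  refine Nat.card_congr (Submodule.Quotient.equiv _ _ (zkerCoords n j) ?_).toEquiv
  have h : (zkerCoords n j : ZkerC n j →ₗ[ℤ] (LowFace n j → ℤ)) =
      LinearMap.funLeft ℤ ℤ Subtype.val ∘ₗ (ZkerC n j).subtype := rfl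
  change Submodule.map (zkerCoords n j : ZkerC n j →ₗ[ℤ] (LowFace n j → ℤ)) _ = _
  rw [h, Submodule.map_comp, Submodule.map_comap_subtype, inf_eq_right.2 (colSpanC_le n j T),
    colSpanC, Submodule.map_span, ← Set.image_comp, Set.image_eq_range]
  rfl

open Classical in
theorem tree_weight_eq {n j : ℕ} (T : Finset (CFace n (j + 1))) (e : LowFace n j ≃ T) :
    ((if IsTreeC n j T then Nat.card (HsubC n j T) ^ 2 else 0 : ℕ) : ℤ) =
      ((bdLow n j).submatrix id fun i => (e i : CFace n (j + 1))).det ^ 2 := by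
  set A := ((bdLow n j).submatrix id fun i => (e i : CFace n (j + 1)))ᵀ with hA
  have hcomp : (A : LowFace n j → LowFace n j → ℤ) = (fun t : T => (bdLow n j)ᵀ t) ∘ e := rfl
  have hli : LinearIndependent ℤ (fun t : T => (bdZ n j)ᵀ t) ↔ A.det ≠ 0 := by
    rw [linearIndependent_bdZ_col_iff, ← linearIndependent_iff_det_ne_zero, hcomp,
      linearIndependent_equiv]
  have hcard : T.card = Module.finrank ℚ (ZkerCQ n j) := by
    rw [finrank_zkerCQ, Fintype.card_congr e, Fintype.card_coe]
  rw [← Matrix.det_transpose, ← hA]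
  by_cases h0 : A.det = 0
  · rw [if_neg fun h => hli.1 h.1 h0, h0]
    simp
  · have hq : Nat.card (HsubC n j T) = A.det.natAbs := by
      rw [card_hsubC, ← card_quotient_span_rows A h0, hcomp, e.surjective.range_comp]
    rw [if_pos ⟨hli.2 h0, by rwa [hq, Int.natAbs_ne_zero], hcard⟩, hq]
    simp

theorem tauC_eq_lowDet (n j : ℕ) : (tauC n j : ℤ) = lowDet n j := by
  classical
  let e (T : {T : Finset (CFace n (j + 1)) // T.card = Fintype.card (LowFace n j)}) :
      LowFace n j ≃ T.1 := Fintype.equivOfCardEq (by rw [Fintype.card_coe, T.2])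
  rw [lowDet, det_mul_eq_sum_subsets _ _ e, tauC, Nat.cast_sum]
  rw [← Finset.sum_subset (Finset.subset_univ (Finset.univ.filter
    fun T : Finset (CFace n (j + 1)) => T.card = Fintype.card (LowFace n j)))]
  · rw [Finset.sum_subtype (p := fun T => T.card = Fintype.card (LowFace n j)) _ (by simp)]
    refine Finset.sum_congr rfl fun T _ => ?_
    rw [tree_weight_eq T.1 (e T), sq, ← Matrix.transpose_submatrix, Matrix.det_transpose]
  · intro T _ hT
    rw [if_neg fun h => hT (by simp [h.2.2, finrank_zkerCQ]), Nat.cast_zero]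

/-- **Spanning tree enumeration for cubes** (Duval–Klivans–Martin, Cor. 3.5).
For `n ≥ 1` and `1 ≤ k = j + 1 ≤ n`,
`τ_k(Q_n) = ∏_{l = k+1}^n (2l)^{binom(n,l)·binom(l-2,k-1)}`
(an empty product, equal to `1`, when `k = n`). -/
theorem cube_spanning_tree_count (n j : ℕ) (hn : 1 ≤ n) (hk : j + 1 ≤ n) :
    tauC n j = ∏ l ∈ Finset.Icc (j + 2) n, (2 * l) ^ (n.choose l * (l - 2).choose j) := by
  apply Nat.cast_injective (R := ℤ)
  rw [tauC_eq_lowDet, lowDet_eq]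
  push_cast
  refine (Finset.prod_subset (Finset.Icc_subset_Icc_left (by omega)) fun l hl hl' => ?_).symm
  rw [Finset.mem_Icc] at hl hl'
  rw [Nat.choose_eq_zero_of_lt (show l - 2 < j by omega), mul_zero, pow_zero]

end CubicalPaper
end

section
/- Algebraically weighted up-down Laplacian spectra of cubes: Let n ≥ 1 and let q_i, x_i, y_i (1 ≤ i ≤ n) be real numbers with x_i ≠ 0 and y_i ≠ 0 for all i. For A ⊆ {1,…,n} set u_A = Σ_{j∈A} (q_j²/x_j² + q_j²/y_j²). Then for every 0 ≤ k ≤ n−1, the characteristic polynomial of the weighted up-down Laplacian L̂^ud_k(Q_n) = ∂̂_{k+1}∂̂_{k+1}^T equals y^{c_k} · ∏_{A ⊆ {1,…,n}, |A| ≥ k+1} (y − u_A)^{binom(|A|−1,k)}, where c_k = binom(n,k)·2^{n−k} − Σ_{j=k+1}^n binom(n,j)·binom(j−1,k). -/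
open BigOperators Matrix

namespace CubicalPaper

/-- The partial order on `Q_n`: `f ≤ g` iff `f i = g i` whenever `g i ≠ ✱`. -/
def cubeLE {n : ℕ} (f g : Face n) : Prop := ∀ i, g i ≠ 2 → f i = g i

/-- A proper cubical complex: a downward-closed set of faces of `Q_n`. -/
def IsComplex {n : ℕ} (X : Finset (Face n)) : Prop :=
  ∀ g ∈ X, ∀ f, cubeLE f g → f ∈ X

/-- The `k`-dimensional faces of `X`. -/
def faceSet {n : ℕ} (X : Finset (Face n)) (k : ℕ) : Finset (Face n) :=
  X.filter fun f => fdim f = k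

/-- The real cubical boundary matrix `∂_{k+1}` of `X`, with rows indexed by `X_k`
and columns by `X_{k+1}`, entries `ε(f, g)`. -/
def bdryM {n : ℕ} (X : Finset (Face n)) (k : ℕ) :
    Matrix {f // f ∈ faceSet X k} {g // g ∈ faceSet X (k + 1)} ℝ :=
  Matrix.of fun f g => (eps f.1 g.1 : ℝ)

/-- The up-down Laplacian `L^ud_k = ∂_{k+1} ∂_{k+1}^T`. -/
noncomputable def Lud {n : ℕ} (X : Finset (Face n)) (k : ℕ) :
    Matrix {f // f ∈ faceSet X k} {f // f ∈ faceSet X k} ℝ :=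
  bdryM X k * (bdryM X k)ᵀ

/-- The down-up Laplacian `L^du_k = ∂_k^T ∂_k` (with `∂_0 = 0`). -/
noncomputable def Ldu {n : ℕ} (X : Finset (Face n)) :
    (k : ℕ) → Matrix {f // f ∈ faceSet X k} {f // f ∈ faceSet X k} ℝ
  | 0 => 0
  | (j + 1) => (bdryM X j)ᵀ * bdryM X j

/-- The total Laplacian `L^tot_k = L^ud_k + L^du_k`. -/
noncomputable def Ltot {n : ℕ} (X : Finset (Face n)) (k : ℕ) :
    Matrix {f // f ∈ faceSet X k} {f // f ∈ faceSet X k} ℝ :=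
  Lud X k + Ldu X k

/-- The spectrum `s^tot_k(X)` of `L^tot_k`: the multiset of roots of its characteristic
polynomial (all of which are real, `L^tot_k` being real symmetric). -/
noncomputable def stot {n : ℕ} (X : Finset (Face n)) (k : ℕ) : Multiset ℝ :=
  (Ltot X k).charpoly.roots

/-- The spectrum `s^ud_k(X)` of `L^ud_k`. -/
noncomputable def sud {n : ℕ} (X : Finset (Face n)) (k : ℕ) : Multiset ℝ :=
  (Lud X k).charpoly.roots

/-- The algebraically weighted cubical boundary matrix `∂̂_{k+1}` of the full cube
`Q_n`: the `(f, g)` entry is `ε(f,g) · q a / x a` if `f` is obtained from `g` by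
changing the `✱` in position `a` to `0`, and `ε(f,g) · q a / y a` if it is changed
to `1`. -/
noncomputable def wbdryM {n : ℕ} (q x y : Fin n → ℝ) (k : ℕ) :
    Matrix {f // f ∈ faceSet (Finset.univ : Finset (Face n)) k}
      {g // g ∈ faceSet (Finset.univ : Finset (Face n)) (k + 1)} ℝ :=
  Matrix.of fun f g =>
    (eps f.1 g.1 : ℝ) *
      ∑ a : Fin n,
        if g.1 a = 2 ∧ f.1 a ≠ 2 ∧ ∀ b, b ≠ a → f.1 b = g.1 b then
          (if f.1 a = 0 then q a / x a else q a / y a)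
        else 0

/-- The weighted up-down Laplacian `L̂^ud_k = ∂̂_{k+1} ∂̂_{k+1}^T` of `Q_n`. -/
noncomputable def wLud {n : ℕ} (q x y : Fin n → ℝ) (k : ℕ) :
    Matrix {f // f ∈ faceSet (Finset.univ : Finset (Face n)) k}
      {f // f ∈ faceSet (Finset.univ : Finset (Face n)) k} ℝ :=
  wbdryM q x y k * (wbdryM q x y k)ᵀ

/-- The weighted down-up Laplacian `L̂^du_k = ∂̂_k^T ∂̂_k` of `Q_n` (with `∂̂_0 = 0`). -/
noncomputable def wLdu {n : ℕ} (q x y : Fin n → ℝ) :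
    (k : ℕ) → Matrix {f // f ∈ faceSet (Finset.univ : Finset (Face n)) k}
      {f // f ∈ faceSet (Finset.univ : Finset (Face n)) k} ℝ
  | 0 => 0
  | (j + 1) => (wbdryM q x y j)ᵀ * wbdryM q x y j

/-- The weighted total Laplacian `L̂^tot_k = L̂^ud_k + L̂^du_k` of `Q_n`. -/
noncomputable def wLtot {n : ℕ} (q x y : Fin n → ℝ) (k : ℕ) :
    Matrix {f // f ∈ faceSet (Finset.univ : Finset (Face n)) k}
      {f // f ∈ faceSet (Finset.univ : Finset (Face n)) k} ℝ :=
  wLud q x y k + wLdu q x y k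

section Tensor

variable {n : ℕ}

/-- The tensor product of `n` matrices of size `3`, acting on functions on faces. -/
def tensor (m : Fin n → Matrix (Fin 3) (Fin 3) ℝ) : Matrix (Face n) (Face n) ℝ :=
  Matrix.of fun f g => ∏ i, m i (f i) (g i)

theorem tensor_apply (m : Fin n → Matrix (Fin 3) (Fin 3) ℝ) (f g : Face n) :
    tensor m f g = ∏ i, m i (f i) (g i) := rfl

theorem tensor_mul (m m' : Fin n → Matrix (Fin 3) (Fin 3) ℝ) :
    tensor m * tensor m' = tensor fun i => m i * m' i := by
  ext f g
  simp only [tensor_apply, Matrix.mul_apply, Finset.prod_univ_sum, Fintype.piFinset_univ,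
    ← Finset.prod_mul_distrib]

theorem tensor_transpose (m : Fin n → Matrix (Fin 3) (Fin 3) ℝ) :
    (tensor m)ᵀ = tensor fun i => (m i)ᵀ := rfl

theorem tensor_diagonal (d : Fin n → Fin 3 → ℝ) :
    (tensor fun i => Matrix.diagonal (d i)) = Matrix.diagonal fun f => ∏ i, d i (f i) := by
  ext f g
  rw [tensor_apply]
  by_cases h : f = g
  · subst h
    simp
  · rw [Matrix.diagonal_apply_ne _ h]
    obtain ⟨i, hi⟩ := Function.ne_iff.1 h
    exact Finset.prod_eq_zero (Finset.mem_univ i) (Matrix.diagonal_apply_ne _ hi)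

theorem tensor_one : (tensor fun _ : Fin n => 1) = 1 := by
  have h := tensor_diagonal fun (_ : Fin n) (_ : Fin 3) => (1 : ℝ)
  simpa using h

theorem tensor_neg_of_eq {m m' : Fin n → Matrix (Fin 3) (Fin 3) ℝ} (a : Fin n)
    (ha : m a = -m' a) (hb : ∀ b, b ≠ a → m b = m' b) : tensor m = -tensor m' := by
  ext f g
  rw [Matrix.neg_apply, tensor_apply, tensor_apply, ← Finset.mul_prod_erase _ _ (Finset.mem_univ a),
    ← Finset.mul_prod_erase Finset.univ (fun i => m' i (f i) (g i)) (Finset.mem_univ a), ha,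
    Matrix.neg_apply, neg_mul]
  congr 2
  exact Finset.prod_congr rfl fun b h => by rw [hb b (Finset.ne_of_mem_erase h)]

/-- The matrix `m` acting in the tensor factor `a`. -/
def site (a : Fin n) (m : Matrix (Fin 3) (Fin 3) ℝ) : Matrix (Face n) (Face n) ℝ :=
  tensor fun b => if b = a then m else 1

theorem site_apply (a : Fin n) (m : Matrix (Fin 3) (Fin 3) ℝ) (f g : Face n) :
    site a m f g = m (f a) (g a) *
      ∏ i ∈ Finset.univ.erase a, (1 : Matrix (Fin 3) (Fin 3) ℝ) (f i) (g i) := by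
  rw [site, tensor_apply, ← Finset.mul_prod_erase _ _ (Finset.mem_univ a), if_pos rfl]
  congr 1
  exact Finset.prod_congr rfl fun b h => by rw [if_neg (Finset.ne_of_mem_erase h)]

theorem site_add (a : Fin n) (m m' : Matrix (Fin 3) (Fin 3) ℝ) :
    site a (m + m') = site a m + site a m' := by
  ext f g
  simp only [site_apply, Matrix.add_apply, add_mul]

theorem site_zero (a : Fin n) : site a 0 = 0 := by
  ext f g
  simp [site_apply]

theorem site_diagonal (a : Fin n) (d : Fin 3 → ℝ) :
    site a (Matrix.diagonal d) = Matrix.diagonal fun f => d (f a) := by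
  have h := tensor_diagonal fun b : Fin n => if b = a then d else fun _ => 1
  have h₁ : (fun b : Fin n => Matrix.diagonal (if b = a then d else fun _ => 1)) =
      fun b => if b = a then Matrix.diagonal d else 1 := by
    funext b
    split_ifs <;> simp
  rw [h₁] at h
  rw [site, h]
  congr 1
  funext f
  rw [Finset.prod_eq_single a (fun b _ hb => by simp [hb]) (by simp), if_pos rfl]

theorem site_conj {p p' : Fin n → Matrix (Fin 3) (Fin 3) ℝ} (h : ∀ i, p i * p' i = 1)
    (a : Fin n) (m : Matrix (Fin 3) (Fin 3) ℝ) :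
    tensor p * site a m * tensor p' = site a (p a * m * p' a) := by
  rw [site, tensor_mul, tensor_mul, site]
  congr 1
  funext b
  by_cases hb : b = a
  · subst hb
    simp
  · simp [hb, h]

/-- The grading operator on a tensor factor: the sign of a `✱` is `-1`. -/
def sgn : Matrix (Fin 3) (Fin 3) ℝ := Matrix.diagonal ![1, 1, -1]

theorem sgn_mul_sgn : sgn * sgn = 1 := by
  rw [sgn, Matrix.diagonal_mul_diagonal, ← Matrix.diagonal_one]
  congr 1
  funext i
  fin_cases i <;> simp

/-- The matrix `m` acting in the tensor factor `a`, with the sign rule for passing it through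
the factors on the left. -/
def signedSite (a : Fin n) (m : Matrix (Fin 3) (Fin 3) ℝ) : Matrix (Face n) (Face n) ℝ :=
  tensor fun b => if b < a then sgn else if b = a then m else 1

theorem signedSite_transpose (a : Fin n) (m : Matrix (Fin 3) (Fin 3) ℝ) :
    (signedSite a m)ᵀ = signedSite a mᵀ := by
  rw [signedSite, tensor_transpose, signedSite]
  congr 1
  funext b
  split_ifs <;> simp [sgn]

theorem signedSite_mul_self (a : Fin n) (m m' : Matrix (Fin 3) (Fin 3) ℝ) :
    signedSite a m * signedSite a m' = site a (m * m') := by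
  rw [signedSite, signedSite, tensor_mul, site]
  congr 1
  funext b
  rcases lt_trichotomy b a with h | h | h
  · simp [h, h.ne, sgn_mul_sgn]
  · simp [h]
  · simp [h.not_gt, h.ne']

theorem signedSite_anticomm {a b : Fin n} (hab : a ≠ b) {m m' : Matrix (Fin 3) (Fin 3) ℝ}
    (hm : sgn * m = -(m * sgn)) (hm' : sgn * m' = -(m' * sgn)) :
    signedSite a m * signedSite b m' = -(signedSite b m' * signedSite a m) := by
  simp only [signedSite, tensor_mul]
  rcases lt_or_gt_of_ne hab with h | h
  · refine tensor_neg_of_eq a (by simp [h, hm]) fun c hc => ?_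
    rcases lt_trichotomy c b with hcb | rfl | hcb
    · by_cases hca : c < a <;> simp [hcb, hca, hc]
    · simp [hc, h.not_gt]
    · simp [hc, hcb.not_gt, hcb.ne', (h.trans hcb).not_gt]
  · refine tensor_neg_of_eq b (by simp [h, hm']) fun c hc => ?_
    rcases lt_trichotomy c a with hca | rfl | hca
    · by_cases hcb : c < b <;> simp [hca, hcb, hc]
    · simp [hc, h.not_gt]
    · simp [hc, hca.not_gt, hca.ne', (h.trans hca).not_gt]

theorem sum_signedSite_mul_add {m m' : Fin n → Matrix (Fin 3) (Fin 3) ℝ}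
    (hm : ∀ a, sgn * m a = -(m a * sgn)) (hm' : ∀ a, sgn * m' a = -(m' a * sgn)) :
    (∑ a, signedSite a (m a)) * (∑ a, signedSite a (m' a)) +
      (∑ a, signedSite a (m' a)) * (∑ a, signedSite a (m a)) =
    ∑ a, site a (m a * m' a + m' a * m a) := by
  rw [Finset.sum_mul_sum, Finset.sum_mul_sum, Finset.sum_comm (γ := Fin n),
    ← Finset.sum_add_distrib]
  refine Finset.sum_congr rfl fun a _ => ?_
  rw [← Finset.sum_add_distrib, Finset.sum_eq_single a]
  · rw [signedSite_mul_self, signedSite_mul_self, site_add]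
  · intro b _ hb
    rw [signedSite_anticomm hb (hm b) (hm' a), neg_add_cancel]
  · simp

end Tensor

section Boundary

variable {n : ℕ}

/-- The boundary of a weighted interval. -/
noncomputable def edgeBdry (q x y : ℝ) : Matrix (Fin 3) (Fin 3) ℝ :=
  !![0, 0, -(q / x); 0, 0, q / y; 0, 0, 0]

theorem sgn_mul_edgeBdry (q x y : ℝ) :
    sgn * edgeBdry q x y = -(edgeBdry q x y * sgn) := by
  ext i j
  rw [Matrix.neg_apply, sgn, Matrix.diagonal_mul, Matrix.mul_diagonal]
  fin_cases i <;> fin_cases j <;> simp [edgeBdry]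

theorem sgn_mul_edgeBdry_transpose (q x y : ℝ) :
    sgn * (edgeBdry q x y)ᵀ = -((edgeBdry q x y)ᵀ * sgn) := by
  have h := congrArg Matrix.transpose (sgn_mul_edgeBdry q x y)
  simp only [Matrix.transpose_mul, Matrix.transpose_neg, sgn, Matrix.diagonal_transpose] at h
  rw [sgn, h, neg_neg]

theorem edgeBdry_mul_self (q x y : ℝ) : edgeBdry q x y * edgeBdry q x y = 0 := by
  ext i j
  fin_cases i <;> fin_cases j <;> simp [edgeBdry, Matrix.mul_apply, Fin.sum_univ_three]

theorem edgeBdry_apply_eq_zero (q x y : ℝ) {i j : Fin 3} (h : ¬ (j = 2 ∧ i ≠ 2)) :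
    edgeBdry q x y i j = 0 := by
  revert h
  fin_cases i <;> fin_cases j <;> simp [edgeBdry]

/-- The weighted boundary matrix on the faces of all dimensions. -/
noncomputable def fullBdry (q x y : Fin n → ℝ) : Matrix (Face n) (Face n) ℝ :=
  ∑ a, signedSite a (edgeBdry (q a) (x a) (y a))

theorem fullBdry_transpose (q x y : Fin n → ℝ) :
    (fullBdry q x y)ᵀ = ∑ a, signedSite a (edgeBdry (q a) (x a) (y a))ᵀ := by
  simp only [fullBdry, Matrix.transpose_sum, signedSite_transpose]

theorem fullBdry_mul_self (q x y : Fin n → ℝ) : fullBdry q x y * fullBdry q x y = 0 := by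
  have h := sum_signedSite_mul_add (fun a => sgn_mul_edgeBdry (q a) (x a) (y a))
    (fun a => sgn_mul_edgeBdry (q a) (x a) (y a))
  simp only [edgeBdry_mul_self, add_zero, site_zero, Finset.sum_const_zero] at h
  ext f g
  exact self_eq_neg.1 (eq_neg_of_add_eq_zero_left (congrFun (congrFun h f) g))

theorem fullBdry_laplacian (q x y : Fin n → ℝ) :
    fullBdry q x y * (fullBdry q x y)ᵀ + (fullBdry q x y)ᵀ * fullBdry q x y =
      ∑ a, site a (edgeBdry (q a) (x a) (y a) * (edgeBdry (q a) (x a) (y a))ᵀ +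
        (edgeBdry (q a) (x a) (y a))ᵀ * edgeBdry (q a) (x a) (y a)) := by
  rw [fullBdry_transpose, fullBdry]
  exact sum_signedSite_mul_add (fun a => sgn_mul_edgeBdry _ _ _)
    (fun a => sgn_mul_edgeBdry_transpose _ _ _)

/-- `f` is a facet of `g` in the direction `a`. -/
abbrev IsFacet (a : Fin n) (f g : Face n) : Prop :=
  g a = 2 ∧ f a ≠ 2 ∧ ∀ b, b ≠ a → f b = g b

theorem IsFacet.unique {a b : Fin n} {f g : Face n} (h : IsFacet a f g) (h' : IsFacet b f g) :
    b = a := by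
  by_contra hba
  exact h'.2.1 ((h.2.2 b hba).trans h'.1)

theorem IsFacet.fdim_eq {a : Fin n} {f g : Face n} (h : IsFacet a f g) :
    fdim g = fdim f + 1 := by
  have ha : a ∉ dir f := by simp [dir, h.2.1]
  rw [fdim, fdim, ← Finset.card_insert_of_notMem ha]
  congr 1
  ext b
  by_cases hb : b = a
  · simp [dir, hb, h.1]
  · simp [dir, hb, h.2.2 b hb]

theorem signedSite_edgeBdry_eq_zero {a : Fin n} {f g : Face n} (h : ¬ IsFacet a f g) (q x y : ℝ) :
    signedSite a (edgeBdry q x y) f g = 0 := by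
  rw [signedSite, tensor_apply, Finset.prod_eq_zero_iff]
  by_cases h₁ : g a = 2 ∧ f a ≠ 2
  · have h₂ : ∃ b, b ≠ a ∧ f b ≠ g b := by
      by_contra! hc
      exact h ⟨h₁.1, h₁.2, hc⟩
    obtain ⟨b, hb, hfg⟩ := h₂
    refine ⟨b, Finset.mem_univ b, ?_⟩
    by_cases hba : b < a
    · simp [hba, sgn, hfg]
    · simp [hba, hb, hfg]
  · refine ⟨a, Finset.mem_univ a, ?_⟩
    simp [edgeBdry_apply_eq_zero q x y h₁]

theorem signedSite_edgeBdry_of_isFacet {a : Fin n} {f g : Face n} (h : IsFacet a f g)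
    (q x y : ℝ) :
    signedSite a (edgeBdry q x y) f g =
      (-1) ^ ((Finset.univ.filter fun b => g b = 2 ∧ b ≤ a).card + if f a = 1 then 1 else 0) *
        (if f a = 0 then q / x else q / y) := by
  have hset : (Finset.univ.filter fun b => g b = 2 ∧ b ≤ a) =
      insert a (Finset.univ.filter fun b => g b = 2 ∧ b < a) := by
    ext b
    rcases eq_or_ne b a with rfl | hb
    · simp [h.1]
    · simp [hb, le_iff_lt_or_eq]
  have hcard : (Finset.univ.filter fun b => g b = 2 ∧ b ≤ a).card =
      (Finset.univ.filter fun b => g b = 2 ∧ b < a).card + 1 := by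
    rw [hset, Finset.card_insert_of_notMem (by simp)]
  have hprod : ∏ b ∈ Finset.univ.erase a,
      (if b < a then sgn else if b = a then edgeBdry q x y else 1) (f b) (g b) =
      (-1 : ℝ) ^ (Finset.univ.filter fun b => g b = 2 ∧ b < a).card := by
    have hterm : ∀ b ∈ Finset.univ.erase a,
        (if b < a then sgn else if b = a then edgeBdry q x y else 1) (f b) (g b) =
        if g b = 2 ∧ b < a then (-1 : ℝ) else 1 := by
      intro b hb
      have hb := Finset.ne_of_mem_erase hb
      rw [h.2.2 b hb]
      by_cases hba : b < a
      · simp only [hba, if_true, and_true, sgn, Matrix.diagonal_apply_eq]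
        generalize g b = j
        fin_cases j <;> simp
      · simp [hba, hb]
    rw [Finset.prod_congr rfl hterm, Finset.prod_ite, Finset.prod_const_one, mul_one,
      Finset.prod_const]
    congr 2
    ext b
    simp only [Finset.mem_filter, Finset.mem_erase, Finset.mem_univ, and_true, true_and]
    exact ⟨fun hb => hb.2, fun hb => ⟨hb.2.ne, hb⟩⟩
  rw [signedSite, tensor_apply, ← Finset.mul_prod_erase _ _ (Finset.mem_univ a), hprod, hcard]
  have h2 := h.2.1
  simp only [lt_irrefl, if_false, if_true, h.1]
  generalize f a = i at h2
  fin_cases i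
  · simp [edgeBdry, pow_succ]; ring
  · simp [edgeBdry, pow_succ]; ring
  · simp at h2

theorem fullBdry_apply_eq_zero (q x y : Fin n → ℝ) {f g : Face n} (h : fdim g ≠ fdim f + 1) :
    fullBdry q x y f g = 0 := by
  rw [fullBdry, Matrix.sum_apply]
  exact Finset.sum_eq_zero fun a _ => signedSite_edgeBdry_eq_zero (fun hf => h hf.fdim_eq) _ _ _

theorem wbdryM_eq_submatrix (q x y : Fin n → ℝ) (k : ℕ) :
    wbdryM q x y k = (fullBdry q x y).submatrix Subtype.val Subtype.val := by
  ext ⟨f, hf⟩ ⟨g, hg⟩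
  simp only [wbdryM, Matrix.of_apply, Matrix.submatrix_apply, fullBdry, Matrix.sum_apply]
  by_cases h : ∃ a, IsFacet a f g
  · obtain ⟨a, ha⟩ := h
    have hε : eps f g = _ :=
      (Finset.sum_eq_single a (fun b _ hb => if_neg fun hf => hb (ha.unique hf)) (by simp)).trans
        (if_pos ha)
    rw [hε, Finset.sum_eq_single a
        (fun b _ hb => signedSite_edgeBdry_eq_zero (fun hf => hb (ha.unique hf)) _ _ _) (by simp),
      signedSite_edgeBdry_of_isFacet ha]
    push_cast
    congr 1
    exact (Finset.sum_eq_single a (fun b _ hb => if_neg fun hf => hb (ha.unique hf))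
      (by simp)).trans (if_pos ha)
  · push Not at h
    have hε : eps f g = 0 := Finset.sum_eq_zero fun a _ => if_neg (h a)
    rw [hε, Int.cast_zero, zero_mul,
      Finset.sum_eq_zero fun a _ => signedSite_edgeBdry_eq_zero (h a) _ _ _]

end Boundary

section Graded

variable {n : ℕ}

/-- The `k`-dimensional faces of the `n`-cube. -/
abbrev KFace (n k : ℕ) : Type := {f // f ∈ faceSet (Finset.univ : Finset (Face n)) k}

theorem mem_faceSet_univ {k : ℕ} {f : Face n} :
    f ∈ faceSet (Finset.univ : Finset (Face n)) k ↔ fdim f = k := by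
  simp [faceSet]

theorem submatrix_mul_of_support {α β : Type*} (A B : Matrix (Face n) (Face n) ℝ) (k : ℕ)
    (r : α → Face n) (s : β → Face n) (h : ∀ i g, fdim g ≠ k → A (r i) g = 0) :
    (A * B).submatrix r s =
      A.submatrix r (Subtype.val : KFace n k → Face n) *
        B.submatrix (Subtype.val : KFace n k → Face n) s := by
  ext i j
  simp only [Matrix.submatrix_apply, Matrix.mul_apply]
  rw [Finset.sum_coe_sort (faceSet Finset.univ k) fun g => A (r i) g * B g (s j)]
  refine (Finset.sum_subset (Finset.subset_univ _) fun g _ hg => ?_).symm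
  rw [h i g (fun hk => hg (mem_faceSet_univ.2 hk)), zero_mul]

theorem fdim_coe {k : ℕ} (f : KFace n k) :
    fdim f.1 = k := mem_faceSet_univ.1 f.2

theorem wbdryM_mul (q x y : Fin n → ℝ) (k : ℕ) : wbdryM q x y k * wbdryM q x y (k + 1) = 0 := by
  rw [wbdryM_eq_submatrix, wbdryM_eq_submatrix, ← submatrix_mul_of_support, fullBdry_mul_self]
  · rfl
  · intro f g hg
    exact fullBdry_apply_eq_zero _ _ _ (by rwa [fdim_coe])

theorem wLud_eq_submatrix (q x y : Fin n → ℝ) (k : ℕ) :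
    wLud q x y k =
      (fullBdry q x y * (fullBdry q x y)ᵀ).submatrix Subtype.val Subtype.val := by
  rw [wLud, wbdryM_eq_submatrix, Matrix.transpose_submatrix, ← submatrix_mul_of_support]
  intro f g hg
  exact fullBdry_apply_eq_zero _ _ _ (by rwa [fdim_coe])

theorem wLdu_eq_submatrix (q x y : Fin n → ℝ) (k : ℕ) :
    wLdu q x y k =
      ((fullBdry q x y)ᵀ * fullBdry q x y).submatrix Subtype.val Subtype.val := by
  cases k with
  | zero =>
    ext f g
    simp only [wLdu, Matrix.zero_apply, Matrix.submatrix_apply, Matrix.mul_apply,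
      Matrix.transpose_apply]
    refine (Finset.sum_eq_zero fun e _ => ?_).symm
    rw [fullBdry_apply_eq_zero _ _ _ (by rw [fdim_coe]; omega), zero_mul]
  | succ k =>
    rw [wLdu, wbdryM_eq_submatrix, Matrix.transpose_submatrix, ← submatrix_mul_of_support]
    intro f g hg
    exact fullBdry_apply_eq_zero _ _ _ (by rw [fdim_coe]; omega)

end Graded

section Spectrum

open Polynomial

variable {n : ℕ}

/-- Columns: eigenvectors of the Laplacian of a weighted interval. -/
noncomputable def edgeEigenbasis (x y : ℝ) : Matrix (Fin 3) (Fin 3) ℝ :=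
  !![y⁻¹, -x⁻¹, 0; x⁻¹, y⁻¹, 0; 0, 0, 1]

/-- The inverse of `edgeEigenbasis`. -/
noncomputable def edgeEigenbasisInv (x y : ℝ) : Matrix (Fin 3) (Fin 3) ℝ :=
  !![y⁻¹ / (x⁻¹ ^ 2 + y⁻¹ ^ 2), x⁻¹ / (x⁻¹ ^ 2 + y⁻¹ ^ 2), 0;
    -x⁻¹ / (x⁻¹ ^ 2 + y⁻¹ ^ 2), y⁻¹ / (x⁻¹ ^ 2 + y⁻¹ ^ 2), 0; 0, 0, 1]

theorem edgeEigenbasis_mul_inv {x : ℝ} (hx : x ≠ 0) (y : ℝ) :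
    edgeEigenbasis x y * edgeEigenbasisInv x y = 1 := by
  have hs : x⁻¹ ^ 2 + y⁻¹ ^ 2 ≠ 0 := by positivity
  ext i j
  rw [Matrix.mul_apply, Fin.sum_univ_three]
  simp only [edgeEigenbasis, edgeEigenbasisInv]
  generalize x⁻¹ = a at *
  generalize y⁻¹ = b at *
  fin_cases i <;> fin_cases j <;> simp <;> field_simp <;> ring

theorem edge_laplacian_mul_eigenbasis (q x y : ℝ) :
    (edgeBdry q x y * (edgeBdry q x y)ᵀ + (edgeBdry q x y)ᵀ * edgeBdry q x y) *
        edgeEigenbasis x y =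
      edgeEigenbasis x y *
        Matrix.diagonal fun i => if i ≠ 0 then q ^ 2 / x ^ 2 + q ^ 2 / y ^ 2 else 0 := by
  ext i j
  rw [Matrix.mul_diagonal, Matrix.mul_apply, Fin.sum_univ_three]
  simp only [Matrix.add_apply, Matrix.mul_apply, Fin.sum_univ_three, Matrix.transpose_apply,
    edgeEigenbasis, edgeBdry]
  fin_cases i <;> fin_cases j <;> simp <;> ring

theorem edgeEigenbasis_apply_eq_zero (x y : ℝ) {i j : Fin 3} (h : ¬ (i = 2 ↔ j = 2)) :
    edgeEigenbasis x y i j = 0 := by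
  revert h
  fin_cases i <;> fin_cases j <;> simp [edgeEigenbasis]

theorem edgeEigenbasisInv_apply_eq_zero (x y : ℝ) {i j : Fin 3} (h : ¬ (i = 2 ↔ j = 2)) :
    edgeEigenbasisInv x y i j = 0 := by
  revert h
  fin_cases i <;> fin_cases j <;> simp [edgeEigenbasisInv]

theorem tensor_apply_eq_zero_of_fdim_ne {m : Fin n → Matrix (Fin 3) (Fin 3) ℝ}
    (hm : ∀ a i j, ¬ (i = 2 ↔ j = 2) → m a i j = 0) {f g : Face n} (h : fdim g ≠ fdim f) :
    tensor m f g = 0 := by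
  have hne : ∃ a, ¬ (f a = 2 ↔ g a = 2) := by
    by_contra! hc
    exact h (congrArg Finset.card (Finset.filter_congr fun a _ => (hc a).symm))
  obtain ⟨a, ha⟩ := hne
  exact Finset.prod_eq_zero (Finset.mem_univ a) (hm a _ _ ha)

/-- The coordinates in which a face is not `0`. -/
def support (f : Face n) : Finset (Fin n) := Finset.univ.filter fun i => f i ≠ 0

theorem charpoly_wLtot (q x y : Fin n → ℝ) (hx : ∀ i, x i ≠ 0) (k : ℕ) :
    (wLtot q x y k).charpoly = ∏ f : KFace n k,
      (X - C (∑ j ∈ support f.1, (q j ^ 2 / x j ^ 2 + q j ^ 2 / y j ^ 2))) := by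
  set p := fun i => edgeEigenbasis (x i) (y i)
  set p' := fun i => edgeEigenbasisInv (x i) (y i)
  set D : Matrix (Face n) (Face n) ℝ := Matrix.diagonal fun f =>
    ∑ j ∈ support f, (q j ^ 2 / x j ^ 2 + q j ^ 2 / y j ^ 2) with hD
  have hpp : ∀ i, p i * p' i = 1 := fun i => edgeEigenbasis_mul_inv (hx i) (y i)
  have hPP : tensor p * tensor p' = 1 := by
    rw [tensor_mul, funext hpp, tensor_one]
  have hsite : D = ∑ a, site a (Matrix.diagonal fun i =>
      if i ≠ 0 then q a ^ 2 / x a ^ 2 + q a ^ 2 / y a ^ 2 else 0) := by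
    simp only [site_diagonal]
    ext f g
    rw [Matrix.sum_apply]
    by_cases hfg : f = g
    · subst hfg
      simp only [hD, Matrix.diagonal_apply_eq, support, Finset.sum_filter]
    · simp [hD, hfg]
  have hM : fullBdry q x y * (fullBdry q x y)ᵀ + (fullBdry q x y)ᵀ * fullBdry q x y =
      tensor p * (D * tensor p') := by
    rw [fullBdry_laplacian, ← Matrix.mul_assoc, hsite, Matrix.mul_sum, Matrix.sum_mul]
    refine Finset.sum_congr rfl fun a _ => ?_
    rw [site_conj hpp, ← edge_laplacian_mul_eigenbasis, Matrix.mul_assoc, hpp, Matrix.mul_one]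
  have hL : wLtot q x y k = (tensor p * (D * tensor p')).submatrix Subtype.val Subtype.val := by
    rw [wLtot, wLud_eq_submatrix, wLdu_eq_submatrix, ← hM]
    rfl
  rw [hL, submatrix_mul_of_support _ _ k, Matrix.charpoly_mul_comm, ← submatrix_mul_of_support,
    Matrix.mul_assoc, mul_eq_one_comm.1 hPP, Matrix.mul_one, hD,
    Matrix.submatrix_diagonal _ _ Subtype.val_injective, Matrix.charpoly_diagonal]
  · rfl
  · intro f g hg
    rw [hD, Matrix.diagonal_mul, tensor_apply_eq_zero_of_fdim_ne
      (fun a _ _ h => edgeEigenbasisInv_apply_eq_zero _ _ h) (by rwa [fdim_coe]), mul_zero]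
  · intro f g hg
    exact tensor_apply_eq_zero_of_fdim_ne
      (fun a _ _ h => edgeEigenbasis_apply_eq_zero _ _ h) (by rwa [fdim_coe])

theorem card_faceSet_support (k : ℕ) (A : Finset (Fin n)) :
    ((faceSet Finset.univ k).filter fun f => support f = A).card = A.card.choose k := by
  rw [← Finset.card_powersetCard]
  refine Finset.card_nbij' dir (fun S i => if i ∈ S then 2 else if i ∈ A then 1 else 0) ?_ ?_ ?_ ?_
  · intro f hf
    simp only [Finset.coe_filter, Set.mem_ofPred_eq, mem_faceSet_univ] at hf
    simp only [Finset.mem_coe, Finset.mem_powersetCard]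
    refine ⟨fun i hi => ?_, hf.1⟩
    have h2 : f i = 2 := (Finset.mem_filter.1 hi).2
    rw [← hf.2]
    simp [support, h2]
  · intro S hS
    simp only [Finset.mem_coe, Finset.mem_powersetCard] at hS
    simp only [Finset.coe_filter, Set.mem_ofPred_eq, mem_faceSet_univ]
    constructor
    · rw [← hS.2, fdim]
      congr 1
      ext i
      by_cases hi : i ∈ S <;> by_cases hA : i ∈ A <;> simp [dir, hi, hA]
    · ext i
      by_cases hi : i ∈ S <;> by_cases hA : i ∈ A <;> simp [support, hi, hA]
      exact hA (hS.1 hi)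
  · intro f hf
    simp only [Finset.coe_filter, Set.mem_ofPred_eq] at hf
    funext i
    simp only [← hf.2, dir, support, Finset.mem_filter, Finset.mem_univ, true_and]
    generalize f i = j
    fin_cases j <;> simp
  · intro S hS
    ext i
    by_cases hi : i ∈ S <;> by_cases hA : i ∈ A <;> simp [dir, hi, hA]

theorem prod_kFace_support {M : Type*} [CommMonoid M] (k : ℕ) (φ : Finset (Fin n) → M) :
    ∏ f : KFace n k, φ (support f.1) = ∏ A, φ A ^ A.card.choose k := by
  rw [Finset.prod_coe_sort (faceSet Finset.univ k) fun f => φ (support f),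
    ← Finset.prod_fiberwise _ support]
  refine Finset.prod_congr rfl fun A _ => ?_
  rw [Finset.prod_congr rfl fun f hf => by rw [(Finset.mem_filter.1 hf).2], Finset.prod_const,
    card_faceSet_support]

theorem card_dir_eq (S : Finset (Fin n)) :
    (Finset.univ.filter fun f : Face n => dir f = S).card = 2 ^ (n - S.card) := by
  have h : (Finset.univ.filter fun f : Face n => dir f = S) =
      Fintype.piFinset fun i => if i ∈ S then {2} else {0, 1} := by
    ext f
    simp only [Finset.mem_filter, Finset.mem_univ, true_and, Fintype.mem_piFinset,
      Finset.ext_iff, dir]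
    refine forall_congr' fun i => ?_
    by_cases hi : i ∈ S
    · simp [hi]
    · simp only [hi, iff_false, if_false]
      generalize f i = j
      fin_cases j <;> simp
  rw [h, Fintype.card_piFinset]
  have h₂ : ∀ i, (if i ∈ S then ({2} : Finset (Fin 3)) else {0, 1}).card =
      if i ∈ S then 1 else 2 := by
    intro i
    split_ifs <;> rfl
  simp only [h₂, Finset.prod_ite, Finset.prod_const, one_pow, one_mul]
  rw [Finset.filter_not, Finset.filter_mem_eq_inter, Finset.univ_inter,
    Finset.card_sdiff_of_subset (Finset.subset_univ S), Finset.card_univ, Fintype.card_fin]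

theorem card_kFace (n k : ℕ) : Fintype.card (KFace n k) = n.choose k * 2 ^ (n - k) := by
  rw [Fintype.card_coe, Finset.card_eq_sum_card_fiberwise (f := dir)
    (t := Finset.powersetCard k Finset.univ)]
  · rw [Finset.sum_congr rfl (g := fun _ => 2 ^ (n - k)), Finset.sum_const,
      Finset.card_powersetCard, Finset.card_univ, Fintype.card_fin, smul_eq_mul]
    intro S hS
    rw [Finset.mem_powersetCard] at hS
    rw [← hS.2, ← card_dir_eq, faceSet, Finset.filter_filter]
    congr 1
    refine Finset.filter_congr fun f _ => ⟨fun h => h.2, fun h => ⟨?_, h⟩⟩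
    rw [fdim, h]
  · intro f hf
    have hk : (dir f).card = k := mem_faceSet_univ.1 hf
    simpa using hk

theorem charpoly_mul_charpoly_of_mul_eq_zero {ι R : Type*} [Fintype ι] [DecidableEq ι]
    [CommRing R] {A B : Matrix ι ι R} (h : A * B = 0) :
    A.charpoly * B.charpoly = X ^ Fintype.card ι * (A + B).charpoly := by
  rw [Matrix.charpoly, Matrix.charpoly, Matrix.charpoly, ← Matrix.det_mul, ← Matrix.det_smul]
  congr 1
  have hC : (C : R →+* R[X]).mapMatrix A * (C : R →+* R[X]).mapMatrix B = 0 := by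
    rw [← map_mul, h, map_zero]
  simp only [Matrix.charmatrix, map_add, Matrix.sub_mul, Matrix.mul_sub, hC, Matrix.scalar_apply,
    ← Matrix.smul_one_eq_diagonal, Matrix.smul_mul, Matrix.mul_smul,
    Matrix.one_mul, Matrix.mul_one, smul_sub, smul_add]
  abel

theorem charpoly_wLud_zero (q x y : Fin n → ℝ) :
    (wLud q x y 0).charpoly = (wLtot q x y 0).charpoly := by
  rw [wLtot, wLdu, add_zero]

theorem charpoly_wLud_succ (q x y : Fin n → ℝ) (k : ℕ) :
    (wLud q x y (k + 1)).charpoly * (wLud q x y k).charpoly =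
      X ^ Fintype.card (KFace n k) * (wLtot q x y (k + 1)).charpoly := by
  have h₁ : wLud q x y (k + 1) * wLdu q x y (k + 1) = 0 := by
    rw [wLud, wLdu, Matrix.mul_assoc, ← Matrix.mul_assoc (wbdryM q x y (k + 1))ᵀ,
      ← Matrix.transpose_mul, wbdryM_mul, Matrix.transpose_zero, Matrix.zero_mul, Matrix.mul_zero]
  have h₂ := charpoly_mul_charpoly_of_mul_eq_zero h₁
  have h₃ := Matrix.charpoly_mul_comm' (wbdryM q x y k) (wbdryM q x y k)ᵀ
  refine mul_left_cancel₀ (pow_ne_zero (Fintype.card (KFace n (k + 1))) X_ne_zero) ?_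
  calc _ = (wLud q x y (k + 1)).charpoly *
        (X ^ Fintype.card (KFace n (k + 1)) * (wLud q x y k).charpoly) := by ring
    _ = X ^ Fintype.card (KFace n k) *
        ((wLud q x y (k + 1)).charpoly * (wLdu q x y (k + 1)).charpoly) := by
      rw [wLud.eq_1 q x y k, h₃, wLdu]
      ring
    _ = _ := by
      rw [h₂, wLtot]
      ring

/-- The product of the factors `φ A` with the multiplicities of the up-down Laplacian. -/
noncomputable def udProd (φ : Finset (Fin n) → ℝ[X]) (k : ℕ) : ℝ[X] :=
  ∏ A ∈ Finset.univ.filter (fun A : Finset (Fin n) => k + 1 ≤ A.card), φ A ^ (A.card - 1).choose k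

theorem prod_choose_zero (φ : Finset (Fin n) → ℝ[X]) :
    ∏ A, φ A ^ A.card.choose 0 = φ ∅ * udProd φ 0 := by
  have h : (Finset.univ.filter fun A : Finset (Fin n) => 0 + 1 ≤ A.card) = Finset.univ.erase ∅ := by
    ext A
    simp [Nat.one_le_iff_ne_zero]
  rw [udProd, h]
  simp only [Nat.choose_zero_right, pow_one]
  exact (Finset.mul_prod_erase _ _ (Finset.mem_univ _)).symm

theorem prod_choose_succ (φ : Finset (Fin n) → ℝ[X]) (k : ℕ) :
    ∏ A, φ A ^ A.card.choose (k + 1) = udProd φ k * udProd φ (k + 1) := by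
  rw [udProd, udProd, Finset.prod_filter, Finset.prod_filter, ← Finset.prod_mul_distrib]
  refine Finset.prod_congr rfl fun A _ => ?_
  generalize A.card = c
  have key : ∀ m j : ℕ, (if j + 1 ≤ m + 1 then φ A ^ m.choose j else 1) = φ A ^ m.choose j := by
    intro m j
    split_ifs with h
    · rfl
    · rw [Nat.choose_eq_zero_of_lt (by omega), pow_zero]
  cases c with
  | zero => simp
  | succ m => simp only [Nat.add_sub_cancel, key, Nat.choose_succ_succ, pow_add]

theorem natDegree_udProd (u : Finset (Fin n) → ℝ) (k : ℕ) :
    (udProd (fun A => X - C (u A)) k).natDegree =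
      ∑ j ∈ Finset.Icc (k + 1) n, n.choose j * (j - 1).choose k := by
  rw [udProd, natDegree_prod_of_monic _ _ fun A _ => (monic_X_sub_C _).pow _]
  simp only [natDegree_pow, natDegree_X_sub_C, mul_one]
  have h := Finset.sum_powerset_apply_card (fun j => if k + 1 ≤ j then (j - 1).choose k else 0)
    (x := (Finset.univ : Finset (Fin n)))
  rw [Finset.powerset_univ, Finset.card_univ, Fintype.card_fin] at h
  rw [Finset.sum_filter, h]
  simp only [smul_eq_mul, mul_ite, mul_zero]
  rw [← Finset.sum_filter]
  congr 1
  ext j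
  simp
  omega

theorem monic_udProd (u : Finset (Fin n) → ℝ) (k : ℕ) :
    (udProd (fun A => X - C (u A)) k).Monic :=
  monic_prod_of_monic _ _ fun _ _ => (monic_X_sub_C _).pow _

theorem natDegree_charpoly_wLud {q x y : Fin n → ℝ} {k e : ℕ} {u : Finset (Fin n) → ℝ}
    (h : (wLud q x y k).charpoly = X ^ e * udProd (fun A => X - C (u A)) k) :
    Fintype.card (KFace n k) =
      e + ∑ j ∈ Finset.Icc (k + 1) n, n.choose j * (j - 1).choose k := by
  rw [← (wLud q x y k).charpoly_natDegree_eq_dim, h, (monic_X_pow e).natDegree_mul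
    (monic_udProd u k), natDegree_X_pow, natDegree_udProd]

theorem exists_charpoly_wLud (q x y : Fin n → ℝ) (hx : ∀ i, x i ≠ 0) (k : ℕ) :
    ∃ e, (wLud q x y k).charpoly = X ^ e * udProd
      (fun A => X - C (∑ j ∈ A, (q j ^ 2 / x j ^ 2 + q j ^ 2 / y j ^ 2))) k := by
  set u : Finset (Fin n) → ℝ := fun A => ∑ j ∈ A, (q j ^ 2 / x j ^ 2 + q j ^ 2 / y j ^ 2)
  have htot : ∀ k, (wLtot q x y k).charpoly = ∏ A, (X - C (u A)) ^ A.card.choose k := fun k =>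
    (charpoly_wLtot q x y hx k).trans (prod_kFace_support k fun A => X - C (u A))
  induction k with
  | zero =>
    refine ⟨1, ?_⟩
    rw [charpoly_wLud_zero, htot, prod_choose_zero fun A => X - C (u A)]
    simp [u]
  | succ k ih =>
    obtain ⟨e, he⟩ := ih
    have hcard := natDegree_charpoly_wLud he
    refine ⟨∑ j ∈ Finset.Icc (k + 1) n, n.choose j * (j - 1).choose k, ?_⟩
    have hrec := charpoly_wLud_succ q x y k
    rw [htot, prod_choose_succ fun A => X - C (u A), he, hcard, pow_add] at hrec
    refine mul_right_cancel₀ (mul_ne_zero (pow_ne_zero e X_ne_zero) (monic_udProd u k).ne_zero) ?_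
    rw [hrec]
    ring

end Spectrum

/-- **Algebraically weighted up-down Laplacian spectra of cubes**
(Duval–Klivans–Martin, Thm. 4.1, eqn. (4.4)).  With
`u_A = Σ_{j ∈ A} (q_j²/x_j² + q_j²/y_j²)`, the characteristic polynomial of
`L̂^ud_k(Q_n)` equals `y^{c_k} · ∏_{A ⊆ [n], |A| ≥ k+1} (y - u_A)^{binom(|A|-1, k)}`,
where `c_k = binom(n,k)·2^{n-k} - Σ_{j=k+1}^n binom(n,j)·binom(j-1,k)`. -/
theorem weighted_cube_ud_spectrum (n : ℕ) (hn : 1 ≤ n)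
    (q x y : Fin n → ℝ) (hx : ∀ i, x i ≠ 0) (hy : ∀ i, y i ≠ 0)
    (k : ℕ) (hk : k ≤ n - 1) :
    (wLud q x y k).charpoly =
      Polynomial.X ^
          (n.choose k * 2 ^ (n - k) -
            ∑ j ∈ Finset.Icc (k + 1) n, n.choose j * (j - 1).choose k) *
        ∏ A ∈ Finset.univ.filter (fun A : Finset (Fin n) => k + 1 ≤ A.card),
          (Polynomial.X -
              Polynomial.C (∑ j ∈ A, (q j ^ 2 / x j ^ 2 + q j ^ 2 / y j ^ 2))) ^
            ((A.card - 1).choose k) := by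
  obtain ⟨e, he⟩ := exists_charpoly_wLud q x y hx k
  have hcard := natDegree_charpoly_wLud he
  rw [card_kFace] at hcard
  rw [he, hcard, Nat.add_sub_cancel, udProd]

end CubicalPaper
end
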